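/- arXiv:1905.10917 — 2 statements merged into one kernel-verified Lean document; each statement's English description precedes it below -/
import Mathlib

section
/- (Over-parametrized lazy TD learning: exponential convergence.) Assume σ_min > 0, where σ_min is the smallest singular value of DV₀ := DV_{w₀} (so DV₀DV₀ᵀ is invertible). Assume ‖V_{w₀}‖₀ < M := (1−γ)² σ_min² / (192 κ² L ‖DV₀‖) and let α > ‖V*‖₀ / M. Let w : [0,∞) → ℝ^p be continuously differentiable and satisfy for all t ≥ 0 the scaled TD ODE dw/dt = (1/α) DV_{w(t)}ᵀ Γ (T^λ(α V_{w(t)}) − α V_{w(t)}). Then for all t ≥ 0, ‖V* − α V_{w(t)}‖₀² ≤ ‖V* − α V_{w₀}‖₀² · e^{−(1−γ) t / (2κ²)}. -/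
open Matrix
open scoped BigOperators

/-- The μ-weighted inner product on ℝ^d. -/
noncomputable def muInner {d : ℕ} (μ a b : Fin d → ℝ) : ℝ := ∑ i, μ i * a i * b i

/-- The μ-weighted norm on ℝ^d. -/
noncomputable def muNorm {d : ℕ} (μ a : Fin d → ℝ) : ℝ := Real.sqrt (muInner μ a a)

/-- The Euclidean norm on ℝ^n. -/
noncomputable def eNorm {n : ℕ} (v : Fin n → ℝ) : ℝ := Real.sqrt (∑ i, v i ^ 2)

/-- The operator norm of a d×p real matrix, induced by the Euclidean norms. -/
noncomputable def matOpNorm {d p : ℕ} (A : Matrix (Fin d) (Fin p) ℝ) : ℝ :=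
  ‖LinearMap.toContinuousLinearMap (Matrix.toEuclideanLin A)‖

/-- P^λ := (1−λ) Σ_{m=0}^∞ (λγ)^m P^{m+1}. -/
noncomputable def Plam {d : ℕ} (P : Matrix (Fin d) (Fin d) ℝ) (γ lam : ℝ) :
    Matrix (Fin d) (Fin d) ℝ :=
  (1 - lam) • ∑' m : ℕ, (lam * γ) ^ m • P ^ (m + 1)

/-- r̄^λ := (1−λ) Σ_{m=0}^∞ λ^m Σ_{t=0}^m γ^t P^t r̄. -/
noncomputable def rlam {d : ℕ} (P : Matrix (Fin d) (Fin d) ℝ) (γ lam : ℝ)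
    (rbar : Fin d → ℝ) : Fin d → ℝ :=
  (1 - lam) • ∑' m : ℕ, lam ^ m • (∑ t ∈ Finset.range (m + 1), γ ^ t • (P ^ t).mulVec rbar)

/-- The TD operator T^λ V := r̄^λ + γ P^λ V. -/
noncomputable def Tlam {d : ℕ} (P : Matrix (Fin d) (Fin d) ℝ) (γ lam : ℝ)
    (rbar : Fin d → ℝ) (V : Fin d → ℝ) : Fin d → ℝ :=
  rlam P γ lam rbar + γ • (Plam P γ lam).mulVec V

/-- V* := Σ_{t=0}^∞ γ^t P^t r̄. -/
noncomputable def Vstar {d : ℕ} (P : Matrix (Fin d) (Fin d) ℝ) (γ : ℝ)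
    (rbar : Fin d → ℝ) : Fin d → ℝ :=
  ∑' t : ℕ, γ ^ t • (P ^ t).mulVec rbar

/-- The ⟨·,·⟩₀ inner product on ℝ^d induced by g₀ := (A Aᵀ)⁻¹, where A = DV_{w₀}. -/
noncomputable def inner0 {d p : ℕ} (A : Matrix (Fin d) (Fin p) ℝ) (a b : Fin d → ℝ) : ℝ :=
  a ⬝ᵥ (A * Aᵀ)⁻¹.mulVec b

/-- The ‖·‖₀ norm on ℝ^d induced by g₀ := (A Aᵀ)⁻¹, where A = DV_{w₀}. -/
noncomputable def norm0 {d p : ℕ} (A : Matrix (Fin d) (Fin p) ℝ) (a : Fin d → ℝ) : ℝ :=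
  Real.sqrt (inner0 A a a)


namespace LazyTD

/-! ### Euclidean norm facts -/

lemma eNorm_eq {n : ℕ} (v : Fin n → ℝ) : eNorm v = ‖WithLp.toLp 2 v‖ := by
  rw [EuclideanSpace.norm_eq]
  simp [eNorm]

lemma eNorm_nonneg {n : ℕ} (v : Fin n → ℝ) : 0 ≤ eNorm v := Real.sqrt_nonneg _

lemma eNorm_sq {n : ℕ} (v : Fin n → ℝ) : eNorm v ^ 2 = v ⬝ᵥ v := by
  rw [eNorm, Real.sq_sqrt (Finset.sum_nonneg fun i _ => sq_nonneg _)]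
  simp [dotProduct, sq]

lemma eNorm_add_le {n : ℕ} (v u : Fin n → ℝ) : eNorm (v + u) ≤ eNorm v + eNorm u := by
  simp only [eNorm_eq, WithLp.toLp_add]
  exact norm_add_le _ _

lemma eNorm_sub_le {n : ℕ} (v u : Fin n → ℝ) : eNorm (v - u) ≤ eNorm v + eNorm u := by
  simp only [eNorm_eq, WithLp.toLp_sub]
  exact norm_sub_le _ _

lemma eNorm_smul {n : ℕ} (c : ℝ) (v : Fin n → ℝ) : eNorm (c • v) = |c| * eNorm v := by
  simp only [eNorm_eq, WithLp.toLp_smul, norm_smul, Real.norm_eq_abs]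

lemma dot_le {n : ℕ} (v u : Fin n → ℝ) : v ⬝ᵥ u ≤ eNorm v * eNorm u := by
  simpa [dotProduct, eNorm] using Real.sum_mul_le_sqrt_mul_sqrt Finset.univ v u

lemma neg_dot_le {n : ℕ} (v u : Fin n → ℝ) : -(v ⬝ᵥ u) ≤ eNorm v * eNorm u := by
  have h := dot_le (-v) u
  have h2 : eNorm (-v) = eNorm v := by simp [eNorm]
  rw [h2] at h
  simpa using h

lemma eNorm_mulVec_le {d p : ℕ} (A : Matrix (Fin d) (Fin p) ℝ) (v : Fin p → ℝ) :
    eNorm (A.mulVec v) ≤ matOpNorm A * eNorm v := by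
  have h := (LinearMap.toContinuousLinearMap (Matrix.toEuclideanLin A)).le_opNorm
    (WithLp.toLp 2 v)
  rw [eNorm_eq, eNorm_eq]
  exact h

lemma matOpNorm_nonneg {d p : ℕ} (A : Matrix (Fin d) (Fin p) ℝ) : 0 ≤ matOpNorm A :=
  norm_nonneg _

lemma le_of_sq_le_mul {x b : ℝ} (hb : 0 ≤ b) (h : x ^ 2 ≤ b * x) : x ≤ b := by
  by_contra hc
  push Not at hc
  nlinarith

lemma eNorm_transpose_mulVec_le {d p : ℕ} (A : Matrix (Fin d) (Fin p) ℝ) (v : Fin d → ℝ) :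
    eNorm (Aᵀ.mulVec v) ≤ matOpNorm A * eNorm v := by
  apply le_of_sq_le_mul (mul_nonneg (matOpNorm_nonneg A) (eNorm_nonneg v))
  have h1 : eNorm (Aᵀ.mulVec v) ^ 2 = v ⬝ᵥ A.mulVec (Aᵀ.mulVec v) := by
    rw [eNorm_sq, Matrix.mulVec_transpose, Matrix.dotProduct_mulVec]
  rw [h1]
  calc v ⬝ᵥ A.mulVec (Aᵀ.mulVec v) ≤ eNorm v * eNorm (A.mulVec (Aᵀ.mulVec v)) := dot_le _ _
    _ ≤ eNorm v * (matOpNorm A * eNorm (Aᵀ.mulVec v)) := by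
        gcongr
        · exact eNorm_nonneg v
        · exact eNorm_mulVec_le _ _
    _ = _ := by ring

/-! ### The weighted norm -/

/-- scaling by the square root of the weights -/
noncomputable def scal {d : ℕ} (μ : Fin d → ℝ) : (Fin d → ℝ) →ₗ[ℝ] EuclideanSpace ℝ (Fin d) where
  toFun a := WithLp.toLp 2 (fun i => Real.sqrt (μ i) * a i)
  map_add' a b := by ext i; simp [mul_add]
  map_smul' c a := by ext i; simp; ring

lemma muNorm_eq {d : ℕ} (μ : Fin d → ℝ) (hμ : ∀ i, 0 < μ i) (a : Fin d → ℝ) :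
    muNorm μ a = ‖scal μ a‖ := by
  rw [EuclideanSpace.norm_eq, muNorm, muInner]
  congr 1
  refine Finset.sum_congr rfl fun i _ => ?_
  simp [scal, mul_pow, Real.sq_sqrt (hμ i).le]
  ring

lemma muNorm_nonneg {d : ℕ} (μ a : Fin d → ℝ) : 0 ≤ muNorm μ a := Real.sqrt_nonneg _

lemma muInner_self_nonneg {d : ℕ} (μ : Fin d → ℝ) (hμ : ∀ i, 0 < μ i) (a : Fin d → ℝ) :
    0 ≤ muInner μ a a :=
  Finset.sum_nonneg fun i _ => by
    rw [mul_assoc]; exact mul_nonneg (hμ i).le (mul_self_nonneg _)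

lemma muNorm_sq {d : ℕ} (μ : Fin d → ℝ) (hμ : ∀ i, 0 < μ i) (a : Fin d → ℝ) :
    muNorm μ a ^ 2 = muInner μ a a := Real.sq_sqrt (muInner_self_nonneg μ hμ a)

lemma muInner_eq {d : ℕ} (μ : Fin d → ℝ) (hμ : ∀ i, 0 < μ i) (a b : Fin d → ℝ) :
    muInner μ a b = (fun i => Real.sqrt (μ i) * a i) ⬝ᵥ (fun i => Real.sqrt (μ i) * b i) := by
  unfold muInner dotProduct
  refine Finset.sum_congr rfl fun i _ => ?_
  have := Real.mul_self_sqrt (hμ i).le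
  linear_combination (-(a i * b i)) * this

lemma muInner_le {d : ℕ} (μ : Fin d → ℝ) (hμ : ∀ i, 0 < μ i) (a b : Fin d → ℝ) :
    muInner μ a b ≤ muNorm μ a * muNorm μ b := by
  rw [muInner_eq μ hμ, muNorm_eq μ hμ, muNorm_eq μ hμ]
  have := dot_le (fun i => Real.sqrt (μ i) * a i) (fun i => Real.sqrt (μ i) * b i)
  rw [eNorm_eq, eNorm_eq] at this
  exact this

section markov
variable {d : ℕ} (P : Matrix (Fin d) (Fin d) ℝ)
    (hP_nonneg : ∀ i j, 0 ≤ P i j)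
    (hP_row : ∀ i, ∑ j, P i j = 1)
    (μ : Fin d → ℝ)
    (hμ_pos : ∀ i, 0 < μ i)
    (hμ_inv : ∀ j, ∑ i, μ i * P i j = μ j)

include hP_nonneg hP_row in
lemma pow_stoch (m : ℕ) : (∀ i j, 0 ≤ (P ^ m) i j) ∧ ∀ i, ∑ j, (P ^ m) i j = 1 := by
  induction m with
  | zero =>
    refine ⟨fun i j => ?_, fun i => ?_⟩
    · rw [pow_zero, Matrix.one_apply]; split_ifs <;> norm_num
    · simp [Matrix.one_apply]
  | succ m ih =>
    refine ⟨fun i j => ?_, fun i => ?_⟩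
    · rw [pow_succ, Matrix.mul_apply]
      exact Finset.sum_nonneg fun k _ => mul_nonneg (ih.1 _ _) (hP_nonneg _ _)
    · simp only [pow_succ, Matrix.mul_apply]
      rw [Finset.sum_comm]
      simp only [← Finset.mul_sum, hP_row, mul_one, ih.2]

include hP_nonneg hP_row in
lemma pow_le_one' (m : ℕ) (i j) : |(P ^ m) i j| ≤ 1 := by
  obtain ⟨h1, h2⟩ := pow_stoch P hP_nonneg hP_row m
  rw [abs_of_nonneg (h1 i j), ← h2 i]
  exact Finset.single_le_sum (fun k _ => h1 i k) (Finset.mem_univ j)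

include hP_nonneg hP_row hμ_pos hμ_inv in
lemma muNorm_mulVec (a : Fin d → ℝ) : muNorm μ (P.mulVec a) ≤ muNorm μ a := by
  apply Real.sqrt_le_sqrt
  unfold muInner
  have h1 : ∀ i, P.mulVec a i * P.mulVec a i ≤ ∑ j, P i j * (a j * a j) := by
    intro i
    have h := Finset.sum_mul_sq_le_sq_mul_sq Finset.univ (fun j => Real.sqrt (P i j))
      (fun j => Real.sqrt (P i j) * a j)
    have e1 : ∀ j, Real.sqrt (P i j) * (Real.sqrt (P i j) * a j) = P i j * a j := fun j => by
      rw [← mul_assoc, Real.mul_self_sqrt (hP_nonneg i j)]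
    have e2 : ∀ j, (Real.sqrt (P i j) * a j) ^ 2 = P i j * (a j * a j) := fun j => by
      rw [mul_pow, Real.sq_sqrt (hP_nonneg i j)]; ring
    simp only [e1, e2, Real.sq_sqrt (hP_nonneg i _), hP_row, one_mul] at h
    rw [← sq]
    exact h
  calc ∑ i, μ i * P.mulVec a i * P.mulVec a i
      ≤ ∑ i, μ i * ∑ j, P i j * (a j * a j) := by
        refine Finset.sum_le_sum fun i _ => ?_
        rw [mul_assoc]
        exact mul_le_mul_of_nonneg_left (h1 i) (hμ_pos i).le
    _ = ∑ j, (∑ i, μ i * P i j) * (a j * a j) := by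
        simp only [Finset.mul_sum, Finset.sum_mul]
        rw [Finset.sum_comm]
        refine Finset.sum_congr rfl fun i _ => Finset.sum_congr rfl fun j _ => by ring
    _ = _ := by
        refine Finset.sum_congr rfl fun j _ => ?_
        rw [hμ_inv]; ring

include hP_nonneg hP_row hμ_pos hμ_inv in
lemma muNorm_pow_mulVec (m : ℕ) (a : Fin d → ℝ) : muNorm μ ((P ^ m).mulVec a) ≤ muNorm μ a := by
  induction m with
  | zero => simp
  | succ m ih =>
    rw [pow_succ', ← Matrix.mulVec_mulVec]
    exact (muNorm_mulVec P hP_nonneg hP_row μ hμ_pos hμ_inv _).trans ih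

variable (γ lam : ℝ) (hγ0 : 0 < γ) (hγ1 : γ < 1) (hlam0 : 0 ≤ lam) (hlam1 : lam < 1)

include hP_nonneg hP_row in
lemma summable_geom_pow (x : ℝ) (hx0 : 0 ≤ x) (hx1 : x < 1) (k : ℕ) :
    Summable fun m : ℕ => x ^ m • P ^ (m + k) := by
  refine Pi.summable.2 fun i => Pi.summable.2 fun j => ?_
  refine Summable.of_norm_bounded (summable_geometric_of_lt_one hx0 hx1) fun m => ?_
  have h := pow_le_one' P hP_nonneg hP_row (m + k) i j
  simp only [Matrix.smul_apply, smul_eq_mul, norm_mul, Real.norm_eq_abs, abs_pow,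
    abs_of_nonneg hx0]
  exact mul_le_of_le_one_right (pow_nonneg hx0 m) h

lemma hasSum_mulVec {f : ℕ → Matrix (Fin d) (Fin d) ℝ} {S : Matrix (Fin d) (Fin d) ℝ}
    (h : HasSum f S) (a : Fin d → ℝ) : HasSum (fun m => (f m).mulVec a) (S.mulVec a) := by
  refine Pi.hasSum.2 fun i => ?_
  unfold Matrix.mulVec dotProduct
  exact hasSum_sum fun j _ => (Pi.hasSum.1 (Pi.hasSum.1 h i) j).mul_right _

include hP_nonneg hP_row hγ0 hγ1 hlam0 hlam1 in
lemma hasSum_Plam (a : Fin d → ℝ) :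
    HasSum (fun m : ℕ => (1 - lam) • ((lam * γ) ^ m • (P ^ (m + 1)).mulVec a))
      ((Plam P γ lam).mulVec a) := by
  have hx1 : lam * γ < 1 := by nlinarith
  have h := (summable_geom_pow P hP_nonneg hP_row (lam * γ) (by positivity) hx1 1).hasSum
  have h2 := (hasSum_mulVec h a).const_smul (1 - lam)
  simp only [Matrix.smul_mulVec] at h2
  rw [Plam, Matrix.smul_mulVec]
  exact h2

include hP_nonneg hP_row hμ_pos hμ_inv hγ0 hγ1 hlam0 hlam1 in
lemma muNorm_Plam (a : Fin d → ℝ) : muNorm μ ((Plam P γ lam).mulVec a) ≤ muNorm μ a := by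
  have hx1 : lam * γ < 1 := by nlinarith
  have hx0 : 0 ≤ lam * γ := by positivity
  have h := hasSum_Plam P hP_nonneg hP_row γ lam hγ0 hγ1 hlam0 hlam1 a
  have h2 := h.mapL (LinearMap.toContinuousLinearMap (scal μ))
  have hg := (hasSum_geometric_of_lt_one hx0 hx1).mul_left ((1 - lam) * muNorm μ a)
  have h3 := tsum_of_norm_bounded (f := fun m => LinearMap.toContinuousLinearMap (scal μ)
    ((1 - lam) • ((lam * γ) ^ m • (P ^ (m + 1)).mulVec a))) hg (fun m => by
      simp only [map_smul, norm_smul, Real.norm_eq_abs, abs_pow, abs_of_nonneg hx0,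
        abs_of_nonneg (sub_nonneg.2 hlam1.le)]
      have h4 := muNorm_pow_mulVec P hP_nonneg hP_row μ hμ_pos hμ_inv (m + 1) a
      rw [muNorm_eq μ hμ_pos] at h4
      have h5 : (1 - lam) * ((lam * γ) ^ m * ‖scal μ ((P ^ (m + 1)).mulVec a)‖)
          ≤ (1 - lam) * ((lam * γ) ^ m * muNorm μ a) :=
        mul_le_mul_of_nonneg_left (mul_le_mul_of_nonneg_left h4 (by positivity))
          (sub_nonneg.2 hlam1.le)
      refine h5.trans (le_of_eq (by ring)))
  rw [h2.tsum_eq] at h3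
  rw [muNorm_eq μ hμ_pos]
  refine h3.trans ?_
  rw [mul_right_comm]
  refine mul_le_of_le_one_left (muNorm_nonneg _ _) ?_
  rw [← div_eq_mul_inv, div_le_one (by linarith)]
  nlinarith

include hP_nonneg hP_row hγ0 hγ1 hlam0 hlam1 in
lemma rlam_eq (rbar : Fin d → ℝ) : rlam P γ lam rbar
    = Vstar P γ rbar - γ • (Plam P γ lam).mulVec (Vstar P γ rbar) := by
  have hs : Summable fun t : ℕ => γ ^ t • (P ^ t).mulVec rbar := by
    have h := hasSum_mulVec (summable_geom_pow P hP_nonneg hP_row γ hγ0.le hγ1 0).hasSum rbar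
    simp only [add_zero, Matrix.smul_mulVec] at h
    exact h.summable
  set W := Vstar P γ rbar with hW
  have hpart : ∀ m : ℕ, ∑ t ∈ Finset.range (m + 1), γ ^ t • (P ^ t).mulVec rbar
      = W - γ ^ (m + 1) • (P ^ (m + 1)).mulVec W := by
    intro m
    have h1 := hs.sum_add_tsum_nat_add (m + 1)
    have h2 := hs.hasSum.mapL
      (LinearMap.toContinuousLinearMap (γ ^ (m + 1) • Matrix.mulVecLin (P ^ (m + 1))))
    have h3 : ∑' i : ℕ, γ ^ (i + (m + 1)) • (P ^ (i + (m + 1))).mulVec rbar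
        = γ ^ (m + 1) • (P ^ (m + 1)).mulVec W := by
      refine HasSum.tsum_eq ?_
      have h4 : (fun i : ℕ => γ ^ (i + (m + 1)) • (P ^ (i + (m + 1))).mulVec rbar) = fun i =>
          (LinearMap.toContinuousLinearMap (γ ^ (m + 1) • Matrix.mulVecLin (P ^ (m + 1))))
            (γ ^ i • (P ^ i).mulVec rbar) := by
        funext i
        simp only [LinearMap.coe_toContinuousLinearMap', LinearMap.smul_apply,
          Matrix.mulVecLin_apply, Matrix.mulVec_smul, Matrix.mulVec_mulVec, ← pow_add, smul_smul]
        rw [add_comm i (m + 1)]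
      rw [h4]
      exact h2
    rw [h3] at h1
    exact eq_sub_of_add_eq h1
  unfold rlam
  simp only [hpart]
  have hg := ((hasSum_geometric_of_lt_one hlam0 hlam1).smul_const W).const_smul (1 - lam)
  have hp := (hasSum_Plam P hP_nonneg hP_row γ lam hγ0 hγ1 hlam0 hlam1 W).const_smul γ
  have hd := hg.sub hp
  have hne : (1 - lam) ≠ 0 := by linarith
  rw [smul_smul, mul_inv_cancel₀ hne, one_smul] at hd
  have hd2 := hd.const_smul (1 - lam)⁻¹
  have : ∀ m : ℕ, (1 - lam)⁻¹ • ((1 - lam) • lam ^ m • W -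
      γ • (1 - lam) • (lam * γ) ^ m • (P ^ (m + 1)).mulVec W) =
      lam ^ m • (W - γ ^ (m + 1) • (P ^ (m + 1)).mulVec W) := by
    intro m
    ext i
    simp only [Pi.smul_apply, Pi.sub_apply, smul_eq_mul]
    field_simp
    ring
  simp only [this] at hd2
  rw [hd2.tsum_eq, smul_smul, mul_inv_cancel₀ hne, one_smul]

end markov

/-! ### Contraction inequalities for `f - γ P^λ f` -/

section contraction
variable {d : ℕ} (P : Matrix (Fin d) (Fin d) ℝ)
    (hP_nonneg : ∀ i j, 0 ≤ P i j)
    (hP_row : ∀ i, ∑ j, P i j = 1)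
    (μ : Fin d → ℝ)
    (hμ_pos : ∀ i, 0 < μ i)
    (hμ_inv : ∀ j, ∑ i, μ i * P i j = μ j)
    (γ lam : ℝ) (hγ0 : 0 < γ) (hγ1 : γ < 1) (hlam0 : 0 ≤ lam) (hlam1 : lam < 1)

include hP_nonneg hP_row hμ_pos hμ_inv hγ0 hγ1 hlam0 hlam1 in
lemma muInner_contr (f : Fin d → ℝ) :
    (1 - γ) * muNorm μ f ^ 2 ≤ muInner μ f (f - γ • (Plam P γ lam).mulVec f) := by
  have h1 := muInner_le μ hμ_pos f ((Plam P γ lam).mulVec f)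
  have h2 := muNorm_Plam P hP_nonneg hP_row μ hμ_pos hμ_inv γ lam hγ0 hγ1 hlam0 hlam1 f
  have h0 := muNorm_nonneg μ f
  have h3 : muInner μ f (f - γ • (Plam P γ lam).mulVec f)
      = muInner μ f f - γ * muInner μ f ((Plam P γ lam).mulVec f) := by
    unfold muInner
    rw [Finset.mul_sum, ← Finset.sum_sub_distrib]
    refine Finset.sum_congr rfl fun i _ => ?_
    simp only [Pi.sub_apply, Pi.smul_apply, smul_eq_mul]
    ring
  rw [h3, ← muNorm_sq μ hμ_pos]
  have h4 : muInner μ f ((Plam P γ lam).mulVec f) ≤ muNorm μ f ^ 2 := by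
    refine h1.trans ?_
    rw [sq]
    exact mul_le_mul_of_nonneg_left h2 h0
  nlinarith

include hP_nonneg hP_row hμ_pos hμ_inv hγ0 hγ1 hlam0 hlam1 in
lemma muNorm_contr (f : Fin d → ℝ) :
    muNorm μ (f - γ • (Plam P γ lam).mulVec f) ≤ 2 * muNorm μ f := by
  have h2 := muNorm_Plam P hP_nonneg hP_row μ hμ_pos hμ_inv γ lam hγ0 hγ1 hlam0 hlam1 f
  have h0 := muNorm_nonneg μ f
  rw [muNorm_eq μ hμ_pos, map_sub, map_smul]
  refine (norm_sub_le _ _).trans ?_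
  rw [norm_smul, ← muNorm_eq μ hμ_pos, ← muNorm_eq μ hμ_pos, Real.norm_eq_abs, abs_of_pos hγ0]
  nlinarith [muNorm_nonneg μ ((Plam P γ lam).mulVec f)]

include hP_nonneg hP_row hγ0 hγ1 hlam0 hlam1 in
lemma Tlam_sub (rbar v : Fin d → ℝ) : Tlam P γ lam rbar v - v
    = (Vstar P γ rbar - v) - γ • (Plam P γ lam).mulVec (Vstar P γ rbar - v) := by
  rw [Tlam, rlam_eq P hP_nonneg hP_row γ lam hγ0 hγ1 hlam0 hlam1, Matrix.mulVec_sub, smul_sub]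
  abel

end contraction

/-! ### The metric at initialisation -/

/-- the right inverse of `A` -/
noncomputable def rinv {d p : ℕ} (A : Matrix (Fin d) (Fin p) ℝ) : Matrix (Fin p) (Fin d) ℝ :=
  Aᵀ * (A * Aᵀ)⁻¹

section metric
variable {d p : ℕ} (A : Matrix (Fin d) (Fin p) ℝ) (σ : ℝ) (hσ : 0 < σ)
  (hσmin : ∀ u : Fin d → ℝ, σ * eNorm u ≤ eNorm (Aᵀ.mulVec u))

include hσ hσmin in
lemma gram_isUnit : IsUnit (A * Aᵀ).det := by
  rw [isUnit_iff_ne_zero]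
  intro h0
  obtain ⟨v, hv, hv0⟩ := Matrix.exists_mulVec_eq_zero_iff.2 h0
  have h1 : eNorm (Aᵀ.mulVec v) ^ 2 = 0 := by
    rw [eNorm_sq, Matrix.mulVec_transpose, ← Matrix.dotProduct_mulVec, ← Matrix.mulVec_transpose,
      Matrix.mulVec_mulVec, hv0, dotProduct_zero]
  have h2 : eNorm (Aᵀ.mulVec v) = 0 := by simpa using h1
  have h3 := hσmin v
  rw [h2] at h3
  have h4 : eNorm v = 0 := le_antisymm (by nlinarith [eNorm_nonneg v]) (eNorm_nonneg v)
  rw [eNorm_eq, norm_eq_zero] at h4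
  apply hv
  simpa using h4

include hσ hσmin in
lemma gram_mul_inv (x : Fin d → ℝ) : (A * Aᵀ).mulVec ((A * Aᵀ)⁻¹.mulVec x) = x := by
  rw [Matrix.mulVec_mulVec, Matrix.mul_nonsing_inv _ (gram_isUnit A σ hσ hσmin), Matrix.one_mulVec]

include hσ hσmin in
lemma inv_mul_gram (x : Fin d → ℝ) : (A * Aᵀ)⁻¹.mulVec ((A * Aᵀ).mulVec x) = x := by
  rw [Matrix.mulVec_mulVec, Matrix.nonsing_inv_mul _ (gram_isUnit A σ hσ hσmin), Matrix.one_mulVec]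

lemma gram_inv_symm : ((A * Aᵀ)⁻¹)ᵀ = (A * Aᵀ)⁻¹ := by
  rw [Matrix.transpose_nonsing_inv, Matrix.transpose_mul, Matrix.transpose_transpose]

lemma inner0_comm (a b : Fin d → ℝ) : inner0 A a b = (A * Aᵀ)⁻¹.mulVec a ⬝ᵥ b := by
  rw [inner0, Matrix.dotProduct_mulVec, ← Matrix.mulVec_transpose, gram_inv_symm]

include hσ hσmin in
lemma rinv_dot (a b : Fin d → ℝ) : (rinv A).mulVec a ⬝ᵥ (rinv A).mulVec b = inner0 A a b := by
  rw [rinv, ← Matrix.mulVec_mulVec, ← Matrix.mulVec_mulVec, Matrix.mulVec_transpose,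
    ← Matrix.dotProduct_mulVec, Matrix.mulVec_mulVec, gram_mul_inv A σ hσ hσmin, inner0_comm]

include hσ hσmin in
lemma rinv_gram (x : Fin d → ℝ) : (rinv A).mulVec ((A * Aᵀ).mulVec x) = Aᵀ.mulVec x := by
  rw [rinv, ← Matrix.mulVec_mulVec, inv_mul_gram A σ hσ hσmin]

include hσ hσmin in
lemma norm0_eq (a : Fin d → ℝ) : norm0 A a = eNorm ((rinv A).mulVec a) := by
  rw [norm0, ← rinv_dot A σ hσ hσmin, ← eNorm_sq, Real.sqrt_sq (eNorm_nonneg _)]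

include hσ hσmin in
lemma norm0_sq (a : Fin d → ℝ) : norm0 A a ^ 2 = inner0 A a a := by
  rw [norm0_eq A σ hσ hσmin, eNorm_sq, rinv_dot A σ hσ hσmin]

include hσ hσmin in
lemma ginv_le (a : Fin d → ℝ) : σ * eNorm ((A * Aᵀ)⁻¹.mulVec a) ≤ norm0 A a := by
  rw [norm0_eq A σ hσ hσmin, rinv, ← Matrix.mulVec_mulVec]
  exact hσmin _

include hσ hσmin in
lemma norm0_le (a : Fin d → ℝ) : norm0 A a ≤ eNorm a / σ := by
  apply le_of_sq_le_mul (div_nonneg (eNorm_nonneg a) hσ.le)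
  rw [norm0_sq A σ hσ hσmin, inner0]
  have h1 := ginv_le A σ hσ hσmin a
  calc _ ≤ eNorm a * eNorm ((A * Aᵀ)⁻¹.mulVec a) := dot_le _ _
    _ ≤ eNorm a * (norm0 A a / σ) := by
      apply mul_le_mul_of_nonneg_left _ (eNorm_nonneg a)
      rw [le_div_iff₀ hσ]; linarith
    _ = _ := by ring

include hσ hσmin in
lemma weighted_le (μ : Fin d → ℝ) (hμ : ∀ i, 0 < μ i) (κ : ℝ) (hκ : 1 ≤ κ)
    (hk : ∀ f : Fin d → ℝ, muNorm μ f ≤ κ * norm0 A f) (h : Fin d → ℝ) :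
    eNorm ((Matrix.diagonal μ).mulVec h) ≤ κ / σ * muNorm μ h := by
  set u := (Matrix.diagonal μ).mulVec h with hu
  apply le_of_sq_le_mul (mul_nonneg (by positivity) (muNorm_nonneg _ _))
  have h1 : eNorm u ^ 2 = muInner μ u h := by
    rw [eNorm_sq]
    unfold dotProduct muInner
    refine Finset.sum_congr rfl fun i _ => ?_
    have : u i = μ i * h i := by rw [hu, Matrix.mulVec_diagonal]
    rw [this]; ring
  rw [h1]
  calc muInner μ u h ≤ muNorm μ u * muNorm μ h := muInner_le μ hμ _ _
    _ ≤ (κ * (eNorm u / σ)) * muNorm μ h := by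
      apply mul_le_mul_of_nonneg_right _ (muNorm_nonneg _ _)
      refine (hk u).trans ?_
      exact mul_le_mul_of_nonneg_left (norm0_le A σ hσ hσmin u) (by linarith)
    _ = _ := by ring

lemma gram_diff_le (B : Matrix (Fin d) (Fin p) ℝ) (D : ℝ) (hD : matOpNorm (B - A) ≤ D)
    (v : Fin d → ℝ) : eNorm ((B * Bᵀ - A * Aᵀ).mulVec v)
      ≤ (2 * matOpNorm A + D) * D * eNorm v := by
  have hD0 : 0 ≤ D := (matOpNorm_nonneg _).trans hD
  have hv := eNorm_nonneg v
  have e : B * Bᵀ - A * Aᵀ = (B - A) * Aᵀ + A * (B - A)ᵀ + (B - A) * (B - A)ᵀ := by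
    rw [Matrix.transpose_sub]
    simp only [Matrix.mul_sub, Matrix.sub_mul]
    abel
  set Δ := B - A
  rw [e, Matrix.add_mulVec, Matrix.add_mulVec]
  simp only [← Matrix.mulVec_mulVec]
  have h1 : ∀ x, eNorm (Δ.mulVec x) ≤ D * eNorm x := fun x =>
    (eNorm_mulVec_le Δ x).trans (mul_le_mul_of_nonneg_right hD (eNorm_nonneg x))
  have h2 : eNorm (Δᵀ.mulVec v) ≤ D * eNorm v :=
    (eNorm_transpose_mulVec_le Δ v).trans (mul_le_mul_of_nonneg_right hD hv)
  have h3 := eNorm_transpose_mulVec_le A v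
  have h4 := eNorm_mulVec_le A (Δᵀ.mulVec v)
  have a0 := matOpNorm_nonneg A
  have h5 := mul_le_mul_of_nonneg_left h3 hD0
  have h6 := mul_le_mul_of_nonneg_left h2 hD0
  have h7 := mul_le_mul_of_nonneg_left h2 a0
  refine (eNorm_add_le _ _).trans ?_
  have h8 := eNorm_add_le (Δ.mulVec (Aᵀ.mulVec v)) (A.mulVec (Δᵀ.mulVec v))
  have h9 := h1 (Aᵀ.mulVec v)
  have h10 := h1 (Δᵀ.mulVec v)
  nlinarith

end metric

/-! ### ODE comparison lemmas -/

lemma decay (n n' : ℝ → ℝ) (c T : ℝ) (hT : 0 ≤ T)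
    (hn : ∀ t ∈ Set.Icc 0 T, HasDerivAt n (n' t) t)
    (hle : ∀ t ∈ Set.Icc 0 T, n' t ≤ -c * n t) : n T ≤ n 0 * Real.exp (-c * T) := by
  have hd : ∀ t ∈ Set.Icc 0 T, HasDerivAt (fun t => n t * Real.exp (c * t))
      (n' t * Real.exp (c * t) + n t * (Real.exp (c * t) * c)) t := by
    intro t ht
    refine (hn t ht).mul ?_
    have := ((hasDerivAt_id t).const_mul c).exp
    simpa using this
  have hanti : AntitoneOn (fun t => n t * Real.exp (c * t)) (Set.Icc 0 T) := by
    apply antitoneOn_of_deriv_nonpos (convex_Icc 0 T)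
    · exact fun t ht => (hd t ht).continuousAt.continuousWithinAt
    · intro t ht
      exact (hd t (interior_subset ht)).differentiableAt.differentiableWithinAt
    · intro t ht
      rw [(hd t (interior_subset ht)).deriv]
      have h1 := hle t (interior_subset ht)
      have h2 := Real.exp_pos (c * t)
      nlinarith
  have h := hanti (Set.left_mem_Icc.2 hT) (Set.right_mem_Icc.2 hT) hT
  simp only [mul_zero, Real.exp_zero, mul_one] at h
  calc n T = n T * Real.exp (c * T) * Real.exp (-c * T) := by
        rw [mul_assoc, ← Real.exp_add]; simp
    _ ≤ _ := mul_le_mul_of_nonneg_right h (Real.exp_pos _).le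

lemma drift_aux {m φ η κ : ℝ} (hκ : 0 < κ) (hm : 0 ≤ m) (hφ : 0 < φ) (hη : 0 < η)
    (h : φ ≤ κ * m + η) : m ≤ κ * m ^ 2 / φ + η / κ := by
  rw [div_add_div _ _ hφ.ne' hκ.ne', le_div_iff₀ (by positivity)]
  by_cases h1 : φ ≤ κ * m
  · have : m * κ * φ ≤ m * κ * (κ * m) := by gcongr
    nlinarith [mul_pos hφ hη]
  · push Not at h1
    nlinarith [mul_nonneg (sub_nonneg.2 h1.le) (sub_nonneg.2 h), mul_nonneg hm hκ.le]

lemma drift {E : Type*} [NormedAddCommGroup E] [NormedSpace ℝ E]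
    (n n' m : ℝ → ℝ) (q q' : ℝ → E) (c κ C T : ℝ) (hT : 0 ≤ T)
    (hc : 0 < c) (hκ : 0 < κ) (hC : 0 ≤ C)
    (hn : ∀ t ∈ Set.Icc 0 T, HasDerivAt n (n' t) t)
    (hle : ∀ t ∈ Set.Icc 0 T, n' t ≤ -c * m t ^ 2)
    (hn0 : ∀ t ∈ Set.Icc 0 T, 0 ≤ n t)
    (hm0 : ∀ t ∈ Set.Icc 0 T, 0 ≤ m t)
    (hnm : ∀ t ∈ Set.Icc 0 T, Real.sqrt (n t) ≤ κ * m t)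
    (hq : ∀ t ∈ Set.Icc 0 T, HasDerivAt q (q' t) t)
    (hqle : ∀ t ∈ Set.Icc 0 T, ‖q' t‖ ≤ C * m t)
    (hq0 : q 0 = 0) : ‖q T‖ ≤ C * (2 * κ / c) * Real.sqrt (n 0) := by
  have key : ∀ η > 0, ‖q T‖ ≤ C * (2 * κ / c) * (Real.sqrt (n 0) + η) + C * (η / κ) * T := by
    intro η hη
    set φ : ℝ → ℝ := fun t => Real.sqrt (n t + η ^ 2) with hφ
    have hpos : ∀ t ∈ Set.Icc 0 T, 0 < n t + η ^ 2 := fun t ht => by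
      have := hn0 t ht; positivity
    have hφpos : ∀ t ∈ Set.Icc 0 T, 0 < φ t := fun t ht => Real.sqrt_pos.2 (hpos t ht)
    have hφle : ∀ t ∈ Set.Icc 0 T, φ t ≤ Real.sqrt (n t) + η := fun t ht => by
      rw [hφ]
      apply Real.sqrt_le_iff.2
      have h1 := Real.sq_sqrt (hn0 t ht)
      have h2 := Real.sqrt_nonneg (n t)
      refine ⟨by positivity, by nlinarith⟩
    have hφd : ∀ t ∈ Set.Icc 0 T, HasDerivAt φ (n' t / (2 * φ t)) t := fun t ht =>
      ((hn t ht).add_const (η ^ 2)).sqrt (hpos t ht).ne'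
    have hB : ∀ t ∈ Set.Icc 0 T, HasDerivAt
        (fun t => C * (2 * κ / c) * (φ 0 - φ t) + C * (η / κ) * t)
        (C * (2 * κ / c) * (-(n' t / (2 * φ t))) + C * (η / κ)) t := fun t ht => by
      have h1 := ((hφd t ht).const_sub (φ 0)).const_mul (C * (2 * κ / c))
      have h2 := (hasDerivAt_id t).const_mul (C * (η / κ))
      have h3 := h1.add h2
      rw [mul_one] at h3
      exact h3
    have hmain := image_norm_le_of_norm_deriv_right_le_deriv_boundary' (f := q) (f' := q')
      (a := 0) (b := T)
      (B := fun t => C * (2 * κ / c) * (φ 0 - φ t) + C * (η / κ) * t)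
      (B' := fun t => C * (2 * κ / c) * (-(n' t / (2 * φ t))) + C * (η / κ))
      (fun t ht => (hq t ht).continuousAt.continuousWithinAt)
      (fun t ht => (hq t (Set.Ico_subset_Icc_self ht)).hasDerivWithinAt)
      (by simp [hq0])
      (fun t ht => (hB t ht).continuousAt.continuousWithinAt)
      (fun t ht => (hB t (Set.Ico_subset_Icc_self ht)).hasDerivWithinAt)
      (fun t ht => by
        have ht' := Set.Ico_subset_Icc_self ht
        refine (hqle t ht').trans ?_
        have hp := hφpos t ht'
        have h1 := drift_aux hκ (hm0 t ht') hp hη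
          ((hφle t ht').trans (by linarith [hnm t ht']))
        have h2 : κ * m t ^ 2 / φ t ≤ (2 * κ / c) * (-(n' t / (2 * φ t))) := by
          have h3 : (2 * κ / c) * (-(n' t / (2 * φ t))) = κ * (-(n' t) / c) / φ t := by
            field_simp
          rw [h3]
          gcongr
          rw [le_div_iff₀ hc]
          linarith [hle t ht']
        calc C * m t ≤ C * ((2 * κ / c) * (-(n' t / (2 * φ t))) + η / κ) :=
              mul_le_mul_of_nonneg_left (h1.trans (by linarith)) hC
          _ = _ := by ring)
      (Set.right_mem_Icc.2 hT)
    refine hmain.trans ?_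
    have h1 := hφle 0 (Set.left_mem_Icc.2 hT)
    have h2 := hφpos T (Set.right_mem_Icc.2 hT)
    have : C * (2 * κ / c) * (φ 0 - φ T) ≤ C * (2 * κ / c) * (Real.sqrt (n 0) + η) :=
      mul_le_mul_of_nonneg_left (by linarith) (by positivity)
    linarith
  have hlim : Filter.Tendsto
      (fun η : ℝ => C * (2 * κ / c) * (Real.sqrt (n 0) + η) + C * (η / κ) * T)
      (nhdsWithin 0 (Set.Ioi 0)) (nhds (C * (2 * κ / c) * Real.sqrt (n 0))) := by
    have hcont : Continuous
        (fun η : ℝ => C * (2 * κ / c) * (Real.sqrt (n 0) + η) + C * (η / κ) * T) := by fun_prop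
    have := hcont.tendsto 0
    simp only [add_zero, zero_div, mul_zero, zero_mul] at this
    exact this.mono_left nhdsWithin_le_nhds
  exact ge_of_tendsto hlim (Filter.eventually_of_mem self_mem_nhdsWithin key)

lemma bootstrap (δ : ℝ → ℝ) (D : ℝ) (hD : 0 < D) (hδ : ContinuousOn δ (Set.Ici 0)) (h0 : δ 0 = 0)
    (hstep : ∀ T, 0 ≤ T → (∀ s ∈ Set.Icc 0 T, δ s ≤ D) → δ T < D) :
    ∀ t, 0 ≤ t → δ t ≤ D := by
  intro t ht
  by_contra hlt
  push Not at hlt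
  have hK : IsCompact (Set.Icc 0 t ∩ δ ⁻¹' Set.Ici D) := by
    apply isCompact_Icc.of_isClosed_subset _ Set.inter_subset_left
    exact (hδ.mono Set.Icc_subset_Ici_self).preimage_isClosed_of_isClosed isClosed_Icc isClosed_Ici
  obtain ⟨s, hs⟩ := hK.exists_isLeast ⟨t, ⟨ht, le_rfl⟩, hlt.le⟩
  have hsD : D ≤ δ s := hs.1.2
  have hs0 : 0 ≤ s := hs.1.1.1
  have hbefore : ∀ r ∈ Set.Ico 0 s, δ r < D := by
    intro r hr
    by_contra hc
    push Not at hc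
    have := hs.2 ⟨⟨hr.1, hr.2.le.trans hs.1.1.2⟩, hc⟩
    linarith [hr.2]
  have hspos : 0 < s := by
    rcases hs0.eq_or_lt with h | h
    · rw [← h, h0] at hsD; linarith
    · exact h
  have hsle : δ s ≤ D := by
    have hc : ContinuousWithinAt δ (Set.Ico 0 s) s :=
      (hδ s hs0).mono (fun r hr => hr.1)
    have hne : (nhdsWithin s (Set.Ico 0 s)).NeBot := by
      rw [← mem_closure_iff_nhdsWithin_neBot, closure_Ico hspos.ne]
      exact ⟨hs0, le_rfl⟩
    exact le_of_tendsto hc (Filter.eventually_of_mem self_mem_nhdsWithin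
      fun r hr => (hbefore r hr).le)
  have := hstep s hs0 (fun r hr => by
    rcases hr.2.eq_or_lt with h | h
    · rw [h]; exact hsle
    · exact (hbefore r ⟨hr.1, h⟩).le)
  linarith

/-! ### Pointwise estimates -/

section pointwise
variable {d p : ℕ} (A B : Matrix (Fin d) (Fin p) ℝ) (σ : ℝ) (hσ : 0 < σ)
  (hσmin : ∀ u : Fin d → ℝ, σ * eNorm u ≤ eNorm (Aᵀ.mulVec u))

include hσ hσmin in
lemma energy_le (μ : Fin d → ℝ) (f h : Fin d → ℝ) (D κ γ m : ℝ)
    (hD : matOpNorm (B - A) ≤ D)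
    (hm : 0 ≤ m) (hκ : 1 ≤ κ)
    (hfm : norm0 A f ≤ κ * m)
    (hy : eNorm ((Matrix.diagonal μ).mulVec h) ≤ κ / σ * (2 * m))
    (hc : (1 - γ) * m ^ 2 ≤ muInner μ f h)
    (hnum : 4 * κ ^ 2 / σ ^ 2 * ((2 * matOpNorm A + D) * D) ≤ 1 - γ) :
    2 * inner0 A f (-((B * Bᵀ).mulVec ((Matrix.diagonal μ).mulVec h))) ≤ -(1 - γ) * m ^ 2 := by
  set y := (Matrix.diagonal μ).mulVec h with hydef
  have hfy : f ⬝ᵥ y = muInner μ f h := by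
    unfold dotProduct muInner
    refine Finset.sum_congr rfl fun i _ => ?_
    rw [hydef, Matrix.mulVec_diagonal]; ring
  have e1 : -((B * Bᵀ).mulVec y) = -((A * Aᵀ).mulVec y) - (B * Bᵀ - A * Aᵀ).mulVec y := by
    rw [Matrix.sub_mulVec]; abel
  have e2 : inner0 A f (-((B * Bᵀ).mulVec y))
      = - muInner μ f h - (A * Aᵀ)⁻¹.mulVec f ⬝ᵥ (B * Bᵀ - A * Aᵀ).mulVec y := by
    rw [e1, inner0_comm, dotProduct_sub, dotProduct_neg, ← inner0_comm, inner0,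
      inv_mul_gram A σ hσ hσmin, hfy]
  have hD0 : 0 ≤ D := (matOpNorm_nonneg _).trans hD
  have a0 := matOpNorm_nonneg A
  have h1 := neg_dot_le ((A * Aᵀ)⁻¹.mulVec f) ((B * Bᵀ - A * Aᵀ).mulVec y)
  have h2 : eNorm ((A * Aᵀ)⁻¹.mulVec f) ≤ κ * m / σ := by
    rw [le_div_iff₀ hσ]
    linarith [ginv_le A σ hσ hσmin f]
  have h3 : eNorm ((B * Bᵀ - A * Aᵀ).mulVec y)
      ≤ (2 * matOpNorm A + D) * D * (κ / σ * (2 * m)) :=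
    (gram_diff_le A B D hD y).trans (mul_le_mul_of_nonneg_left hy (by positivity))
  have h4 := mul_le_mul h2 h3 (eNorm_nonneg _) (by positivity)
  have h5 : 2 * (κ * m / σ * ((2 * matOpNorm A + D) * D * (κ / σ * (2 * m))))
      = (4 * κ ^ 2 / σ ^ 2 * ((2 * matOpNorm A + D) * D)) * m ^ 2 := by
    field_simp
    ring
  have h6 := mul_le_mul_of_nonneg_right hnum (sq_nonneg m)
  rw [e2]
  linarith

include hσ hσmin in
lemma drift_le (y : Fin d → ℝ) (D Y : ℝ) (hD : matOpNorm (B - A) ≤ D) (hy : eNorm y ≤ Y) :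
    eNorm (Bᵀ.mulVec y - (rinv A).mulVec ((B * Bᵀ).mulVec y))
      ≤ (D + (2 * matOpNorm A + D) * D / σ) * Y := by
  have hD0 : 0 ≤ D := (matOpNorm_nonneg _).trans hD
  have a0 := matOpNorm_nonneg A
  have e : Bᵀ.mulVec y - (rinv A).mulVec ((B * Bᵀ).mulVec y)
      = (B - A)ᵀ.mulVec y - (rinv A).mulVec ((B * Bᵀ - A * Aᵀ).mulVec y) := by
    rw [Matrix.sub_mulVec, Matrix.mulVec_sub, rinv_gram A σ hσ hσmin, Matrix.transpose_sub,
      Matrix.sub_mulVec]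
    abel
  rw [e]
  refine (eNorm_sub_le _ _).trans ?_
  rw [← norm0_eq A σ hσ hσmin]
  have h1 : eNorm ((B - A)ᵀ.mulVec y) ≤ D * eNorm y :=
    (eNorm_transpose_mulVec_le _ y).trans (mul_le_mul_of_nonneg_right hD (eNorm_nonneg y))
  have h2 := norm0_le A σ hσ hσmin ((B * Bᵀ - A * Aᵀ).mulVec y)
  have h3 : eNorm ((B * Bᵀ - A * Aᵀ).mulVec y) / σ
      ≤ (2 * matOpNorm A + D) * D * eNorm y / σ :=
    div_le_div_of_nonneg_right (gram_diff_le A B D hD y) hσ.le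
  have h4 : (D + (2 * matOpNorm A + D) * D / σ) * eNorm y
      ≤ (D + (2 * matOpNorm A + D) * D / σ) * Y :=
    mul_le_mul_of_nonneg_left hy (by positivity)
  refine le_trans ?_ h4
  have h5 : (D + (2 * matOpNorm A + D) * D / σ) * eNorm y
      = D * eNorm y + (2 * matOpNorm A + D) * D * eNorm y / σ := by ring
  linarith

end pointwise

/-! ### Arithmetic of the constants -/

lemma const_small {γ σ κ a D : ℝ} (hγ0 : 0 < γ) (hγ1 : γ < 1) (hσ : 0 < σ) (hκ : 1 ≤ κ)
    (ha : σ ≤ a) (hD : D = (1 - γ) * σ ^ 2 / (12 * κ ^ 2 * a)) :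
    0 < D ∧ D ≤ a / 12 ∧ 4 * κ ^ 2 / σ ^ 2 * ((2 * a + D) * D) ≤ 1 - γ := by
  have ha0 : 0 < a := hσ.trans_le ha
  have hg : 0 < 1 - γ := by linarith
  have hκ0 : 0 < κ := by linarith
  have h0 : 0 < D := by rw [hD]; positivity
  have h1 : D ≤ a / 12 := by
    rw [hD, div_le_div_iff₀ (by positivity) (by norm_num)]
    have hs : σ ^ 2 ≤ a ^ 2 := by gcongr
    have hk : 1 ≤ κ ^ 2 := one_le_pow₀ hκ
    have h2 : (1 - γ) * σ ^ 2 ≤ 1 * a ^ 2 :=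
      mul_le_mul (by linarith) hs (by positivity) (by norm_num)
    nlinarith [mul_le_mul_of_nonneg_right hk (sq_nonneg a)]
  refine ⟨h0, h1, ?_⟩
  have h2 : (2 * a + D) * D ≤ (25 / 12 * a) * D :=
    mul_le_mul_of_nonneg_right (by linarith) h0.le
  calc 4 * κ ^ 2 / σ ^ 2 * ((2 * a + D) * D) ≤ 4 * κ ^ 2 / σ ^ 2 * ((25 / 12 * a) * D) :=
        mul_le_mul_of_nonneg_left h2 (by positivity)
    _ = 100 / 144 * (1 - γ) := by rw [hD]; field_simp; ring
    _ ≤ 1 - γ := by linarith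

lemma const_close {γ σ κ a D L M α N0 : ℝ} (hγ0 : 0 < γ) (hγ1 : γ < 1) (hσ : 0 < σ) (hκ : 1 ≤ κ)
    (ha : σ ≤ a) (hL : 0 < L) (hα : 0 < α) (hD : D = (1 - γ) * σ ^ 2 / (12 * κ ^ 2 * a))
    (hM : M = (1 - γ) ^ 2 * σ ^ 2 / (192 * κ ^ 2 * L * a)) (hN : N0 ≤ 2 * M * α) :
    L * (2 * N0 / α + (1 / α * (D + (2 * a + D) * D / σ) * (κ / σ * 2))
      * (2 * κ / (1 - γ)) * N0) < D := by
  obtain ⟨h0, h1, -⟩ := const_small hγ0 hγ1 hσ hκ ha hD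
  have ha0 : 0 < a := hσ.trans_le ha
  have hg : 0 < 1 - γ := by linarith
  have hκ0 : 0 < κ := by linarith
  have hbr : D + (2 * a + D) * D / σ ≤ 37 / 12 * (a / σ) * D := by
    have e : D + (2 * a + D) * D / σ = (1 + (2 * a + D) / σ) * D := by ring
    rw [e]
    apply mul_le_mul_of_nonneg_right _ h0.le
    have : (1 : ℝ) = σ / σ := by field_simp
    rw [this, ← add_div, ← mul_div_assoc]
    apply div_le_div_of_nonneg_right _ hσ.le
    linarith
  have hbr0 : 0 ≤ D + (2 * a + D) * D / σ := by positivity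
  have hM0 : 0 < M := by rw [hM]; positivity
  have hNα : N0 / α ≤ 2 * M := by rw [div_le_iff₀ hα]; exact hN
  have e1 : L * (2 * N0 / α + (1 / α * (D + (2 * a + D) * D / σ) * (κ / σ * 2))
      * (2 * κ / (1 - γ)) * N0)
      = (L * (2 + (D + (2 * a + D) * D / σ) * (κ / σ * 2) * (2 * κ / (1 - γ)))) * (N0 / α) := by
    ring
  rw [e1]
  have h2 : (L * (2 + (D + (2 * a + D) * D / σ) * (κ / σ * 2) * (2 * κ / (1 - γ)))) * (N0 / α)
      ≤ (L * (2 + (37 / 12 * (a / σ) * D) * (κ / σ * 2) * (2 * κ / (1 - γ)))) * (2 * M) := by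
    refine (mul_le_mul_of_nonneg_left hNα (by positivity)).trans ?_
    gcongr
  have h3 : (L * (2 + (37 / 12 * (a / σ) * D) * (κ / σ * 2) * (2 * κ / (1 - γ)))) * (2 * M)
      = L * 4 * M + 37 / 12 * (8 / 192) * (1 - γ) * D := by
    have : (37 / 12 * (a / σ) * D) * (κ / σ * 2) * (2 * κ / (1 - γ)) * (2 * M) * L
        = 37 / 12 * (8 / 192) * (1 - γ) * D := by
      rw [hM]; field_simp; ring
    linarith
  have h4 : L * 4 * M = (1 - γ) * D / 4 := by
    rw [hM, hD]; field_simp; ring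
  rw [h3, h4] at h2
  have h5 : (1 - γ) * D ≤ D := by nlinarith
  linarith

end LazyTD

/-- Over-parametrized lazy TD learning: exponential convergence. If σ_min > 0 is the
smallest singular value of DV₀ := DV_{w₀}, ‖V_{w₀}‖₀ < M := (1−γ)²σ_min²/(192κ²L‖DV₀‖),
α > ‖V*‖₀/M, and w solves the scaled TD ODE
  dw/dt = (1/α) DV_{w(t)}ᵀ Γ (T^λ(αV_{w(t)}) − αV_{w(t)}),
then ‖V* − αV_{w(t)}‖₀² ≤ ‖V* − αV_{w₀}‖₀² e^{−(1−γ)t/(2κ²)} for all t ≥ 0. -/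
theorem overparametrized_lazy_TD_exponential_convergence
    {d p : ℕ} (hd : 0 < d)
    (P : Matrix (Fin d) (Fin d) ℝ)
    (hP_nonneg : ∀ i j, 0 ≤ P i j)
    (hP_row : ∀ i, ∑ j, P i j = 1)
    (μ : Fin d → ℝ)
    (hμ_pos : ∀ i, 0 < μ i)
    (hμ_sum : ∑ i, μ i = 1)
    (hμ_inv : ∀ j, ∑ i, μ i * P i j = μ j)
    (γ lam : ℝ) (hγ0 : 0 < γ) (hγ1 : γ < 1) (hlam0 : 0 ≤ lam) (hlam1 : lam < 1)
    (rbar : Fin d → ℝ)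
    (V : (Fin p → ℝ) → (Fin d → ℝ))
    (DV : (Fin p → ℝ) → Matrix (Fin d) (Fin p) ℝ)
    (hV : ∀ v, HasFDerivAt V (LinearMap.toContinuousLinearMap (Matrix.mulVecLin (DV v))) v)
    (L : ℝ) (hL : 0 < L)
    (hLip : ∀ v v', matOpNorm (DV v - DV v') ≤ L * eNorm (v - v'))
    (w₀ : Fin p → ℝ)
    (σmin : ℝ) (hσ : 0 < σmin)
    (hσmin : ∀ u : Fin d → ℝ, σmin * eNorm u ≤ eNorm ((DV w₀)ᵀ.mulVec u))
    (hσsmall : ∀ σ' : ℝ, (∀ u : Fin d → ℝ, σ' * eNorm u ≤ eNorm ((DV w₀)ᵀ.mulVec u)) → σ' ≤ σmin)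
    (κ : ℝ) (hκ : 1 ≤ κ)
    (hκequiv : ∀ f : Fin d → ℝ,
      κ⁻¹ * norm0 (DV w₀) f ≤ muNorm μ f ∧ muNorm μ f ≤ κ * norm0 (DV w₀) f)
    (α : ℝ)
    (hM : norm0 (DV w₀) (V w₀)
      < (1 - γ) ^ 2 * σmin ^ 2 / (192 * κ ^ 2 * L * matOpNorm (DV w₀)))
    (hα : α > norm0 (DV w₀) (Vstar P γ rbar)
      / ((1 - γ) ^ 2 * σmin ^ 2 / (192 * κ ^ 2 * L * matOpNorm (DV w₀))))
    (w : ℝ → (Fin p → ℝ))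
    (hw0 : w 0 = w₀)
    (hODE : ∀ t : ℝ, 0 ≤ t →
      HasDerivAt w
        ((1 / α) • ((DV (w t))ᵀ.mulVec
          ((Matrix.diagonal μ).mulVec
            (Tlam P γ lam rbar (α • V (w t)) - α • V (w t))))) t) :
    ∀ t : ℝ, 0 ≤ t →
      norm0 (DV w₀) (Vstar P γ rbar - α • V (w t)) ^ 2
        ≤ norm0 (DV w₀) (Vstar P γ rbar - α • V w₀) ^ 2
            * Real.exp (-(1 - γ) * t / (2 * κ ^ 2)) := by

  set A := DV w₀ with hA
  set a := matOpNorm A with ha_def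
  set M := (1 - γ) ^ 2 * σmin ^ 2 / (192 * κ ^ 2 * L * a) with hM_def
  set W := Vstar P γ rbar with hW
  have hκ0 : 0 < κ := by linarith
  have hg : 0 < 1 - γ := by linarith
  -- `σmin ≤ ‖A‖`
  have hσa : σmin ≤ a := by
    have h1 := hσmin (fun _ => 1)
    have h2 := LazyTD.eNorm_transpose_mulVec_le A (fun _ => 1)
    have h3 : 0 < eNorm (fun _ : Fin d => (1 : ℝ)) := by
      apply Real.sqrt_pos.2
      simpa using hd
    exact le_of_mul_le_mul_right (h1.trans h2) h3
  have ha0 : 0 < a := hσ.trans_le hσa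
  have hM0 : 0 < M := by positivity
  have hα0 : 0 < α := lt_of_le_of_lt (div_nonneg (Real.sqrt_nonneg _) hM0.le) hα
  set D := (1 - γ) * σmin ^ 2 / (12 * κ ^ 2 * a) with hD
  obtain ⟨hD0, -, hnum⟩ := LazyTD.const_small hγ0 hγ1 hσ hκ hσa hD
  -- quantities along the trajectory
  set f : ℝ → (Fin d → ℝ) := fun t => W - α • V (w t) with hf
  set h : ℝ → (Fin d → ℝ) := fun t => f t - γ • (Plam P γ lam).mulVec (f t) with hh
  set y : ℝ → (Fin d → ℝ) := fun t => (Matrix.diagonal μ).mulVec (h t) with hy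
  set m : ℝ → ℝ := fun t => muNorm μ (f t) with hm
  have hwd : ∀ t, 0 ≤ t → HasDerivAt w ((1 / α) • (DV (w t))ᵀ.mulVec (y t)) t := by
    intro t ht
    have h1 := hODE t ht
    rw [LazyTD.Tlam_sub P hP_nonneg hP_row γ lam hγ0 hγ1 hlam0 hlam1] at h1
    exact h1
  have hVd : ∀ t, 0 ≤ t → HasDerivAt (fun t => V (w t))
      ((1 / α) • (DV (w t) * (DV (w t))ᵀ).mulVec (y t)) t := by
    intro t ht
    have h1 := (hV (w t)).comp_hasDerivAt t (hwd t ht)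
    have h2 : (LinearMap.toContinuousLinearMap (Matrix.mulVecLin (DV (w t))))
        ((1 / α) • (DV (w t))ᵀ.mulVec (y t))
        = (1 / α) • (DV (w t) * (DV (w t))ᵀ).mulVec (y t) := by
      simp [Matrix.mulVec_smul, Matrix.mulVec_mulVec]
    rw [h2] at h1
    exact h1
  have hfd : ∀ t, 0 ≤ t → HasDerivAt f (-((DV (w t) * (DV (w t))ᵀ).mulVec (y t))) t := by
    intro t ht
    have h1 := ((hVd t ht).const_smul α).const_sub W
    rw [smul_smul, mul_one_div_cancel hα0.ne', one_smul] at h1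
    exact h1
  -- squared norm
  set n : ℝ → ℝ := fun t => norm0 A (f t) ^ 2 with hn
  set n' : ℝ → ℝ := fun t => 2 * inner0 A (f t) (-((DV (w t) * (DV (w t))ᵀ).mulVec (y t))) with hn'
  have hnd : ∀ t, 0 ≤ t → HasDerivAt n (n' t) t := by
    intro t ht
    let K : (Fin d → ℝ) →L[ℝ] EuclideanSpace ℝ (Fin p) :=
      ((PiLp.continuousLinearEquiv 2 ℝ (fun _ : Fin p => ℝ)).symm :
        (Fin p → ℝ) →L[ℝ] EuclideanSpace ℝ (Fin p)).comp
        (LinearMap.toContinuousLinearMap (Matrix.mulVecLin (LazyTD.rinv A)))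
    have hK : ∀ x, K x = WithLp.toLp 2 ((LazyTD.rinv A).mulVec x) := fun x => rfl
    have h1 := (K.hasFDerivAt.comp_hasDerivAt t (hfd t ht)).norm_sq
    have e1 : (fun t => ‖(K ∘ f) t‖ ^ 2) = n := by
      funext s
      simp only [hn, Function.comp, hK, LazyTD.norm0_eq A σmin hσ hσmin, LazyTD.eNorm_eq]
    have e2 : 2 * inner ℝ ((K ∘ f) t) (K (-((DV (w t) * (DV (w t))ᵀ).mulVec (y t)))) = n' t := by
      simp only [hn', Function.comp, hK]
      rw [← LazyTD.rinv_dot A σmin hσ hσmin, EuclideanSpace.inner_eq_star_dotProduct]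
      simp only [star_trivial]
      rw [dotProduct_comm]
    rw [← e1, ← e2]
    exact h1
  -- pointwise bounds
  have hm0 : ∀ t, 0 ≤ m t := fun t => LazyTD.muNorm_nonneg _ _
  have hfm : ∀ t, norm0 A (f t) ≤ κ * m t := by
    intro t
    have h1 := (hκequiv (f t)).1
    rw [inv_mul_le_iff₀ hκ0] at h1
    exact h1
  have hyb : ∀ t, eNorm (y t) ≤ κ / σmin * (2 * m t) := by
    intro t
    refine (LazyTD.weighted_le A σmin hσ hσmin μ hμ_pos κ hκ (fun f => (hκequiv f).2) (h t)).trans ?_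
    exact mul_le_mul_of_nonneg_left (LazyTD.muNorm_contr P hP_nonneg hP_row μ hμ_pos hμ_inv γ lam
      hγ0 hγ1 hlam0 hlam1 (f t)) (by positivity)
  have hcon : ∀ t, (1 - γ) * m t ^ 2 ≤ muInner μ (f t) (h t) := fun t =>
    LazyTD.muInner_contr P hP_nonneg hP_row μ hμ_pos hμ_inv γ lam hγ0 hγ1 hlam0 hlam1 (f t)
  set δ : ℝ → ℝ := fun t => L * eNorm (w t - w₀) with hδ
  have hclose : ∀ t, δ t ≤ D → matOpNorm (DV (w t) - A) ≤ D := fun t ht =>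
    (hLip (w t) w₀).trans ht
  have hen : ∀ t, 0 ≤ t → δ t ≤ D → n' t ≤ -(1 - γ) * m t ^ 2 := fun t ht hδt =>
    LazyTD.energy_le A (DV (w t)) σmin hσ hσmin μ (f t) (h t) D κ γ (m t) (hclose t hδt) (hm0 t) hκ
      (hfm t) (hyb t) (hcon t) hnum
  have hnle : ∀ t, 0 ≤ t → δ t ≤ D → n' t ≤ -((1 - γ) / (2 * κ ^ 2)) * n t := by
    intro t ht hδt
    refine (hen t ht hδt).trans ?_
    have h1 : n t ≤ (κ * m t) ^ 2 := pow_le_pow_left₀ (Real.sqrt_nonneg _) (hfm t) 2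
    have h2 : (1 - γ) / (2 * κ ^ 2) * n t ≤ (1 - γ) / (2 * κ ^ 2) * (κ * m t) ^ 2 :=
      mul_le_mul_of_nonneg_left h1 (by positivity)
    have h3 : (1 - γ) / (2 * κ ^ 2) * (κ * m t) ^ 2 = (1 - γ) * m t ^ 2 / 2 := by
      field_simp
    have h4 : 0 ≤ (1 - γ) * m t ^ 2 := by positivity
    linarith
  have hdecay : ∀ T, 0 ≤ T → (∀ s ∈ Set.Icc 0 T, δ s ≤ D) →
      n T ≤ n 0 * Real.exp (-((1 - γ) / (2 * κ ^ 2)) * T) := fun T hT hs =>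
    LazyTD.decay n n' _ T hT (fun t ht => hnd t ht.1) (fun t ht => hnle t ht.1 (hs t ht))
  have hN0 : norm0 A (f 0) ≤ 2 * M * α := by
    have h1 : norm0 A (f 0) ≤ norm0 A W + α * norm0 A (V w₀) := by
      simp only [hf, hw0, LazyTD.norm0_eq A σmin hσ hσmin, Matrix.mulVec_sub, Matrix.mulVec_smul]
      refine (LazyTD.eNorm_sub_le _ _).trans ?_
      rw [LazyTD.eNorm_smul, abs_of_pos hα0]
    have h2 : norm0 A W ≤ α * M := ((div_lt_iff₀ hM0).1 hα).le
    have h3 := mul_le_mul_of_nonneg_left hM.le hα0.le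
    linarith
  have hball : ∀ t, 0 ≤ t → δ t ≤ D := by
    apply LazyTD.bootstrap δ D hD0
    · intro t ht
      have h1 : ContinuousAt w t := (hwd t ht).continuousAt
      have h2 : Continuous fun v : Fin p → ℝ => L * eNorm (v - w₀) := by
        unfold eNorm
        fun_prop
      exact (h2.continuousAt.comp h1).continuousWithinAt
    · simp [hδ, hw0, eNorm]
    · intro T hT hs
      set q : ℝ → EuclideanSpace ℝ (Fin p) := fun t =>
        WithLp.toLp 2 ((w t - w₀) - (LazyTD.rinv A).mulVec (V (w t) - V w₀)) with hq
      set q' : ℝ → EuclideanSpace ℝ (Fin p) := fun t =>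
        WithLp.toLp 2 ((1 / α) • ((DV (w t))ᵀ.mulVec (y t)
          - (LazyTD.rinv A).mulVec ((DV (w t) * (DV (w t))ᵀ).mulVec (y t)))) with hq'
      have hqd : ∀ t ∈ Set.Icc 0 T, HasDerivAt q (q' t) t := by
        intro t ht
        have h1 := (hwd t ht.1).sub_const w₀
        have h2 := (LinearMap.toContinuousLinearMap
          (Matrix.mulVecLin (LazyTD.rinv A))).hasFDerivAt.comp_hasDerivAt t
          ((hVd t ht.1).sub_const (V w₀))
        have h3 := ((PiLp.continuousLinearEquiv 2 ℝ (fun _ : Fin p => ℝ)).symm :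
          (Fin p → ℝ) →L[ℝ] EuclideanSpace ℝ (Fin p)).hasFDerivAt.comp_hasDerivAt t (h1.sub h2)
        have e : q' t = ((PiLp.continuousLinearEquiv 2 ℝ (fun _ : Fin p => ℝ)).symm :
          (Fin p → ℝ) →L[ℝ] EuclideanSpace ℝ (Fin p)) ((1 / α) • (DV (w t))ᵀ.mulVec (y t) -
            (LinearMap.toContinuousLinearMap (Matrix.mulVecLin (LazyTD.rinv A)))
              ((1 / α) • (DV (w t) * (DV (w t))ᵀ).mulVec (y t))) := by
          rw [map_smul, ← smul_sub]
          rfl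
        rw [e]
        exact h3
      have hqT := LazyTD.drift n n' m q q' (1 - γ) κ
        (1 / α * (D + (2 * a + D) * D / σmin) * (κ / σmin * 2)) T hT hg hκ0 (by positivity)
        (fun t ht => hnd t ht.1) (fun t ht => hen t ht.1 (hs t ht)) (fun t ht => sq_nonneg _)
        (fun t ht => hm0 t)
        (fun t ht => by
          simp only [hn]
          rw [Real.sqrt_sq (show 0 ≤ norm0 A (f t) from Real.sqrt_nonneg _)]
          exact hfm t)
        hqd
        (fun t ht => by
          simp only [hq']
          rw [← LazyTD.eNorm_eq, LazyTD.eNorm_smul, abs_of_pos (by positivity)]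
          have h1 := LazyTD.drift_le A (DV (w t)) σmin hσ hσmin (y t) D _
            (hclose t (hs t ht)) (hyb t)
          have h2 := mul_le_mul_of_nonneg_left h1 (one_div_nonneg.2 hα0.le)
          refine h2.trans (le_of_eq ?_)
          ring)
        (by simp [hq, hw0])
      have hn0 : Real.sqrt (n 0) = norm0 A (f 0) := Real.sqrt_sq (Real.sqrt_nonneg _)
      rw [hn0] at hqT
      have hNT : norm0 A (f T) ≤ norm0 A (f 0) := by
        have h1 := hdecay T hT hs
        have h2 : Real.exp (-((1 - γ) / (2 * κ ^ 2)) * T) ≤ 1 := by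
          apply Real.exp_le_one_iff.2
          have : 0 ≤ (1 - γ) / (2 * κ ^ 2) * T := by positivity
          linarith
        have h3 : n T ≤ n 0 := h1.trans (mul_le_of_le_one_right (sq_nonneg _) h2)
        exact le_of_sq_le_sq h3 (Real.sqrt_nonneg _)
      have hVV : eNorm ((LazyTD.rinv A).mulVec (V (w T) - V w₀)) ≤ 2 * norm0 A (f 0) / α := by
        have e : V (w T) - V w₀ = (1 / α) • (f 0 - f T) := by
          simp only [hf, hw0]
          ext i
          simp only [Pi.sub_apply, Pi.smul_apply, smul_eq_mul]
          field_simp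
          ring
        rw [e, Matrix.mulVec_smul, LazyTD.eNorm_smul, abs_of_pos (by positivity), Matrix.mulVec_sub]
        have h1 := LazyTD.eNorm_sub_le ((LazyTD.rinv A).mulVec (f 0)) ((LazyTD.rinv A).mulVec (f T))
        rw [← LazyTD.norm0_eq A σmin hσ hσmin, ← LazyTD.norm0_eq A σmin hσ hσmin] at h1
        rw [one_div, inv_mul_eq_div]
        apply div_le_div_of_nonneg_right _ hα0.le
        linarith
      have htri : eNorm (w T - w₀) ≤ eNorm ((LazyTD.rinv A).mulVec (V (w T) - V w₀)) + ‖q T‖ := by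
        simp only [hq]
        rw [← LazyTD.eNorm_eq]
        refine le_trans (le_of_eq ?_) (LazyTD.eNorm_add_le _ _)
        congr 1
        abel
      refine lt_of_le_of_lt ?_ (LazyTD.const_close hγ0 hγ1 hσ hκ hσa hL hα0 hD hM_def hN0)
      simp only [hδ]
      apply mul_le_mul_of_nonneg_left _ hL.le
      linarith
  intro t ht
  have h1 := hdecay t ht (fun s hs => hball s hs.1)
  have e1 : -((1 - γ) / (2 * κ ^ 2)) * t = -(1 - γ) * t / (2 * κ ^ 2) := by ring
  rw [e1] at h1
  simp only [hn, hf, hw0] at h1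
  exact h1
end

section
/- (Over-parametrized lazy TD learning: lazy weights.) Under the hypotheses of the over-parametrized convergence theorem (σ_min > 0, ‖V_{w₀}‖₀ < M := (1−γ)² σ_min² / (192 κ² L ‖DV₀‖), α > ‖V*‖₀ / M, and w a continuously differentiable global solution of dw/dt = (1/α) DV_{w(t)}ᵀ Γ (T^λ(α V_{w(t)}) − α V_{w(t)}) with w(0) = w₀), if moreover ‖V_{w₀}‖₀ ≤ C α⁻¹ for some constant C > 0, then for all t ≥ 0: ‖w(t) − w₀‖₂ ≤ (4 κ² / (α (1−γ))) ‖DV₀‖ (C + ‖V*‖₀); in particular sup_{t ≥ 0} ‖w(t) − w₀‖₂ = O(α⁻¹). -/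
open Matrix
open scoped BigOperators

section helpers

lemma eNorm_eq {n : ℕ} (v : Fin n → ℝ) : eNorm v = ‖WithLp.toLp 2 v‖ := by
  simp [eNorm, EuclideanSpace.norm_eq]

lemma eNorm_nonneg {n : ℕ} (v : Fin n → ℝ) : 0 ≤ eNorm v := Real.sqrt_nonneg _

lemma eNorm_sq {n : ℕ} (v : Fin n → ℝ) : v ⬝ᵥ v = eNorm v ^ 2 := by
  rw [eNorm, Real.sq_sqrt (Finset.sum_nonneg fun i _ => sq_nonneg _)]
  simp [dotProduct, sq]

lemma eNorm_add_le {n : ℕ} (v u : Fin n → ℝ) : eNorm (v + u) ≤ eNorm v + eNorm u := by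
  simp only [eNorm_eq, WithLp.toLp_add]; exact norm_add_le _ _

lemma eNorm_sub_le {n : ℕ} (v u : Fin n → ℝ) : eNorm (v - u) ≤ eNorm v + eNorm u := by
  simp only [eNorm_eq, WithLp.toLp_sub]; exact norm_sub_le _ _

lemma eNorm_smul {n : ℕ} (c : ℝ) (v : Fin n → ℝ) : eNorm (c • v) = |c| * eNorm v := by
  simp only [eNorm_eq, WithLp.toLp_smul, norm_smul, Real.norm_eq_abs]

lemma eNorm_eq_zero {n : ℕ} {v : Fin n → ℝ} (h : eNorm v = 0) : v = 0 := by
  have := eNorm_sq v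
  rw [h] at this
  exact dotProduct_self_eq_zero.1 (by simpa using this)

lemma dot_le {n : ℕ} (v u : Fin n → ℝ) : |v ⬝ᵥ u| ≤ eNorm v * eNorm u := by
  have := abs_real_inner_le_norm (WithLp.toLp 2 u) (WithLp.toLp 2 v)
  rw [EuclideanSpace.inner_toLp_toLp] at this
  rw [eNorm_eq, eNorm_eq, mul_comm]
  simpa [dotProduct_comm] using this

lemma eNorm_le_of {n : ℕ} {v : Fin n → ℝ} {c : ℝ} (hc : 0 ≤ c)
    (h : v ⬝ᵥ v ≤ c * eNorm v) : eNorm v ≤ c := by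
  rw [eNorm_sq] at h
  rcases (eNorm_nonneg v).eq_or_lt with h0 | h0
  · rw [← h0]; exact hc
  · nlinarith

lemma matOpNorm_nonneg {d p : ℕ} (A : Matrix (Fin d) (Fin p) ℝ) : 0 ≤ matOpNorm A :=
  norm_nonneg _

lemma eNorm_mulVec_le {d p : ℕ} (A : Matrix (Fin d) (Fin p) ℝ) (x : Fin p → ℝ) :
    eNorm (A *ᵥ x) ≤ matOpNorm A * eNorm x := by
  rw [eNorm_eq, eNorm_eq]
  exact (LinearMap.toContinuousLinearMap (Matrix.toEuclideanLin A)).le_opNorm (WithLp.toLp 2 x)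

lemma dot_mulVec_T {d p : ℕ} (A : Matrix (Fin d) (Fin p) ℝ) (x : Fin p → ℝ) (y : Fin d → ℝ) :
    x ⬝ᵥ (Aᵀ *ᵥ y) = (A *ᵥ x) ⬝ᵥ y := by
  rw [Matrix.dotProduct_mulVec, Matrix.vecMul_transpose]

lemma eNorm_mulVec_T_le {d p : ℕ} (A : Matrix (Fin d) (Fin p) ℝ) (y : Fin d → ℝ) :
    eNorm (Aᵀ *ᵥ y) ≤ matOpNorm A * eNorm y := by
  apply eNorm_le_of (mul_nonneg (matOpNorm_nonneg _) (eNorm_nonneg _))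
  rw [dot_mulVec_T]
  calc _ ≤ _ := le_abs_self _
    _ ≤ _ := dot_le _ _
    _ ≤ (matOpNorm A * eNorm (Aᵀ *ᵥ y)) * eNorm y :=
      mul_le_mul_of_nonneg_right (eNorm_mulVec_le _ _) (eNorm_nonneg _)
    _ = _ := by ring

/-- Aᵀ (A Aᵀ)⁻¹ -/
noncomputable def JJ {d p : ℕ} (A : Matrix (Fin d) (Fin p) ℝ) (a : Fin d → ℝ) : Fin p → ℝ :=
  Aᵀ *ᵥ ((A * Aᵀ)⁻¹ *ᵥ a)

lemma JJ_add {d p : ℕ} (A : Matrix (Fin d) (Fin p) ℝ) (a b : Fin d → ℝ) :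
    JJ A (a + b) = JJ A a + JJ A b := by simp [JJ, Matrix.mulVec_add]
lemma JJ_sub {d p : ℕ} (A : Matrix (Fin d) (Fin p) ℝ) (a b : Fin d → ℝ) :
    JJ A (a - b) = JJ A a - JJ A b := by simp [JJ, Matrix.mulVec_sub]
lemma JJ_smul {d p : ℕ} (A : Matrix (Fin d) (Fin p) ℝ) (c : ℝ) (b : Fin d → ℝ) :
    JJ A (c • b) = c • JJ A b := by simp [JJ, Matrix.mulVec_smul]

section G
variable {d p : ℕ} {A : Matrix (Fin d) (Fin p) ℝ} {σ : ℝ}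

lemma G_unit (hσ : 0 < σ) (h : ∀ u : Fin d → ℝ, σ * eNorm u ≤ eNorm (Aᵀ.mulVec u)) :
    IsUnit (A * Aᵀ).det := by
  rw [← Matrix.isUnit_iff_isUnit_det, ← Matrix.mulVec_injective_iff_isUnit]
  rw [← Matrix.coe_mulVecLin, ← LinearMap.ker_eq_bot, LinearMap.ker_eq_bot']
  intro x hx
  rw [Matrix.mulVecLin_apply, ← Matrix.mulVec_mulVec] at hx
  have h1 : eNorm (Aᵀ *ᵥ x) ^ 2 = 0 := by
    rw [← eNorm_sq, dot_mulVec_T, hx]; simp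
  have h2 := h x
  have h3 : eNorm (Aᵀ *ᵥ x) = 0 := by simpa using h1
  rw [h3] at h2
  apply eNorm_eq_zero
  have := eNorm_nonneg x
  nlinarith

lemma A_JJ (hu : IsUnit (A * Aᵀ).det) (a : Fin d → ℝ) : A *ᵥ JJ A a = a := by
  rw [JJ, Matrix.mulVec_mulVec, Matrix.mulVec_mulVec, Matrix.mul_nonsing_inv _ hu, Matrix.one_mulVec]

lemma JJ_A (hu : IsUnit (A * Aᵀ).det) (y : Fin d → ℝ) : JJ A (A *ᵥ (Aᵀ *ᵥ y)) = Aᵀ *ᵥ y := by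
  rw [JJ, Matrix.mulVec_mulVec y, Matrix.mulVec_mulVec y, Matrix.nonsing_inv_mul _ hu, Matrix.one_mulVec]

lemma inner0_eq (hu : IsUnit (A * Aᵀ).det) (a b : Fin d → ℝ) : inner0 A a b = JJ A a ⬝ᵥ JJ A b := by
  conv_rhs => rw [JJ.eq_def A b, dot_mulVec_T, A_JJ hu]
  rfl

lemma norm0_eq (hu : IsUnit (A * Aᵀ).det) (a : Fin d → ℝ) : norm0 A a = eNorm (JJ A a) := by
  rw [norm0, inner0_eq hu, eNorm_sq, Real.sqrt_sq (eNorm_nonneg _)]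

lemma norm0_sq (hu : IsUnit (A * Aᵀ).det) (a : Fin d → ℝ) : inner0 A a a = norm0 A a ^ 2 := by
  rw [norm0_eq hu, inner0_eq hu, eNorm_sq]

lemma norm0_nonneg (a : Fin d → ℝ) : 0 ≤ norm0 A a := Real.sqrt_nonneg _

lemma norm0_add_le (hu : IsUnit (A * Aᵀ).det) (a b : Fin d → ℝ) :
    norm0 A (a + b) ≤ norm0 A a + norm0 A b := by
  simp only [norm0_eq hu, JJ_add]; exact eNorm_add_le _ _
lemma norm0_sub_le (hu : IsUnit (A * Aᵀ).det) (a b : Fin d → ℝ) :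
    norm0 A (a - b) ≤ norm0 A a + norm0 A b := by
  simp only [norm0_eq hu, JJ_sub]; exact eNorm_sub_le _ _
lemma norm0_smul (hu : IsUnit (A * Aᵀ).det) (c : ℝ) (b : Fin d → ℝ) :
    norm0 A (c • b) = |c| * norm0 A b := by
  simp only [norm0_eq hu, JJ_smul]; exact eNorm_smul _ _

lemma eNorm_G_le (hu : IsUnit (A * Aᵀ).det) (h : ∀ u : Fin d → ℝ, σ * eNorm u ≤ eNorm (Aᵀ.mulVec u))
    (a : Fin d → ℝ) : σ * eNorm ((A * Aᵀ)⁻¹ *ᵥ a) ≤ norm0 A a := by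
  rw [norm0_eq hu]; exact h _

lemma norm0_le (hσ : 0 < σ) (hu : IsUnit (A * Aᵀ).det)
    (h : ∀ u : Fin d → ℝ, σ * eNorm u ≤ eNorm (Aᵀ.mulVec u))
    (a : Fin d → ℝ) : norm0 A a ≤ eNorm a / σ := by
  have h1 := eNorm_G_le hu h a
  have h2 : norm0 A a ^ 2 ≤ eNorm a * eNorm ((A * Aᵀ)⁻¹ *ᵥ a) := by
    rw [← norm0_sq hu]
    exact (le_abs_self _).trans (dot_le _ _)
  rw [le_div_iff₀ hσ]
  have h3 := eNorm_nonneg a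
  have h4 : norm0 A a * (norm0 A a * σ) ≤ norm0 A a * eNorm a := by nlinarith
  rcases (norm0_nonneg (A := A) a).eq_or_lt with h0 | h0
  · rw [← h0]; simpa using h3
  · exact le_of_mul_le_mul_left h4 h0

lemma eNorm_le_norm0 (hu : IsUnit (A * Aᵀ).det) (a : Fin d → ℝ) :
    eNorm a ≤ matOpNorm A * norm0 A a := by
  rw [norm0_eq hu]
  conv_lhs => rw [← A_JJ hu a]
  exact eNorm_mulVec_le _ _

lemma JJA_dot (hu : IsUnit (A * Aᵀ).det) (x : Fin p → ℝ) :
    JJ A (A *ᵥ x) ⬝ᵥ JJ A (A *ᵥ x) = x ⬝ᵥ JJ A (A *ᵥ x) := by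
  rw [← inner0_eq hu, JJ, dot_mulVec_T]; rfl

/-- projection on the kernel -/
noncomputable def QQ (A : Matrix (Fin d) (Fin p) ℝ) (x : Fin p → ℝ) : Fin p → ℝ :=
  x - JJ A (A *ᵥ x)

lemma eNorm_QQ_le (hu : IsUnit (A * Aᵀ).det) (x : Fin p → ℝ) : eNorm (QQ A x) ≤ eNorm x := by
  apply abs_le_of_sq_le_sq' _ (eNorm_nonneg _) |>.2
  have h := JJA_dot hu x
  rw [← eNorm_sq, ← eNorm_sq, QQ]
  have h' : 0 ≤ JJ A (A *ᵥ x) ⬝ᵥ JJ A (A *ᵥ x) := by rw [eNorm_sq]; positivity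
  simp only [sub_dotProduct, dotProduct_sub]
  rw [dotProduct_comm (JJ A (A *ᵥ x)) x]
  linarith

lemma QQ_add_T (hu : IsUnit (A * Aᵀ).det) (x : Fin p → ℝ) (y : Fin d → ℝ) :
    QQ A (x + Aᵀ *ᵥ y) = QQ A x := by
  simp only [QQ, Matrix.mulVec_add, JJ_add, JJ_A hu]; abel

lemma eNorm_split (hu : IsUnit (A * Aᵀ).det) (x : Fin p → ℝ) :
    eNorm x ≤ norm0 A (A *ᵥ x) + eNorm (QQ A x) := by
  rw [norm0_eq hu]
  conv_lhs => rw [show x = JJ A (A *ᵥ x) + QQ A x by simp [QQ]]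
  exact eNorm_add_le _ _

end G

section mu
variable {d : ℕ} {μ : Fin d → ℝ}

/-- scaling by the square root of the weights -/
noncomputable def sm (μ a : Fin d → ℝ) : Fin d → ℝ := fun i => Real.sqrt (μ i) * a i

lemma muInner_eq (hμ : ∀ i, 0 < μ i) (a b : Fin d → ℝ) : muInner μ a b = sm μ a ⬝ᵥ sm μ b := by
  simp only [muInner, dotProduct, sm]
  refine Finset.sum_congr rfl fun i _ => ?_
  have := Real.mul_self_sqrt (hμ i).le
  linear_combination (-(a i * b i)) * this

lemma muNorm_eq (hμ : ∀ i, 0 < μ i) (a : Fin d → ℝ) : muNorm μ a = eNorm (sm μ a) := by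
  rw [muNorm, muInner_eq hμ, eNorm_sq, Real.sqrt_sq (eNorm_nonneg _)]

lemma muNorm_nonneg (a : Fin d → ℝ) : 0 ≤ muNorm μ a := Real.sqrt_nonneg _

lemma muNorm_sq (hμ : ∀ i, 0 < μ i) (a : Fin d → ℝ) : muInner μ a a = muNorm μ a ^ 2 := by
  rw [muNorm_eq hμ, muInner_eq hμ, eNorm_sq]

lemma muInner_le (hμ : ∀ i, 0 < μ i) (a b : Fin d → ℝ) :
    muInner μ a b ≤ muNorm μ a * muNorm μ b := by
  rw [muNorm_eq hμ, muNorm_eq hμ, muInner_eq hμ]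
  exact (le_abs_self _).trans (dot_le _ _)

lemma muNorm_smul (hμ : ∀ i, 0 < μ i) (c : ℝ) (a : Fin d → ℝ) :
    muNorm μ (c • a) = |c| * muNorm μ a := by
  rw [muNorm_eq hμ, muNorm_eq hμ, ← eNorm_smul]
  congr 1; ext i; simp [sm]; ring

lemma muNorm_sub_le (hμ : ∀ i, 0 < μ i) (a b : Fin d → ℝ) :
    muNorm μ (a - b) ≤ muNorm μ a + muNorm μ b := by
  simp only [muNorm_eq hμ]
  refine le_of_eq_of_le ?_ (eNorm_sub_le _ _)
  congr 1; ext i; simp [sm]; ring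

lemma muNorm_le_eNorm (hμ : ∀ i, 0 < μ i) (hs : ∑ i, μ i = 1) (a : Fin d → ℝ) :
    muNorm μ a ≤ eNorm a := by
  apply Real.sqrt_le_sqrt
  refine Finset.sum_le_sum fun i _ => ?_
  have : μ i ≤ 1 := hs ▸ Finset.single_le_sum (fun j _ => (hμ j).le) (Finset.mem_univ i)
  nlinarith [sq_nonneg (a i)]

lemma muNorm_P (P : Matrix (Fin d) (Fin d) ℝ) (hP : ∀ i j, 0 ≤ P i j) (hrow : ∀ i, ∑ j, P i j = 1)
    (hinv : ∀ j, ∑ i, μ i * P i j = μ j)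
    (hμ : ∀ i, 0 < μ i) (a : Fin d → ℝ) : muNorm μ (P *ᵥ a) ≤ muNorm μ a := by
  apply Real.sqrt_le_sqrt
  have key : ∀ i, (P *ᵥ a) i ^ 2 ≤ ∑ j, P i j * a j ^ 2 := by
    intro i
    have h2 := (even_two.convexOn_pow (𝕜 := ℝ)).map_sum_le (t := Finset.univ) (w := fun j => P i j)
      (p := a) (fun j _ => hP i j) (hrow i) (fun _ _ => Set.mem_univ _)
    simpa [Matrix.mulVec, dotProduct] using h2
  calc muInner μ (P *ᵥ a) (P *ᵥ a) = ∑ i, μ i * (P *ᵥ a) i ^ 2 :=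
        Finset.sum_congr rfl fun i _ => by ring
    _ ≤ ∑ i, μ i * ∑ j, P i j * a j ^ 2 :=
        Finset.sum_le_sum fun i _ => mul_le_mul_of_nonneg_left (key i) (hμ i).le
    _ = ∑ j, (∑ i, μ i * P i j) * a j ^ 2 := by
        simp only [Finset.mul_sum, Finset.sum_mul]
        rw [Finset.sum_comm]
        exact Finset.sum_congr rfl fun i _ => Finset.sum_congr rfl fun j _ => by ring
    _ = muInner μ a a := Finset.sum_congr rfl fun j _ => by rw [hinv]; ring

lemma muNorm_Ppow (P : Matrix (Fin d) (Fin d) ℝ) (hP : ∀ i j, 0 ≤ P i j) (hrow : ∀ i, ∑ j, P i j = 1)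
    (hinv : ∀ j, ∑ i, μ i * P i j = μ j)
    (hμ : ∀ i, 0 < μ i) (a : Fin d → ℝ) (m : ℕ) : muNorm μ (P ^ m *ᵥ a) ≤ muNorm μ a := by
  induction m with
  | zero => simp
  | succ m ih =>
    rw [pow_succ', ← Matrix.mulVec_mulVec]
    exact (muNorm_P P hP hrow hinv hμ _).trans ih

lemma sup_P (P : Matrix (Fin d) (Fin d) ℝ) (hP : ∀ i j, 0 ≤ P i j) (hrow : ∀ i, ∑ j, P i j = 1)
    (a : Fin d → ℝ) (m : ℕ) : ‖P ^ m *ᵥ a‖ ≤ ‖a‖ := by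
  induction m with
  | zero => simp
  | succ m ih =>
    rw [pow_succ', ← Matrix.mulVec_mulVec]
    refine le_trans ?_ ih
    generalize P ^ m *ᵥ a = b
    rw [pi_norm_le_iff_of_nonneg (norm_nonneg _)]
    intro i
    calc ‖(P *ᵥ b) i‖ ≤ ∑ j, ‖P i j * b j‖ := norm_sum_le (Finset.univ) (fun j => P i j * b j)
      _ ≤ ∑ j, P i j * ‖b‖ := Finset.sum_le_sum fun j _ => by
          rw [norm_mul, Real.norm_of_nonneg (hP i j)]
          exact mul_le_mul_of_nonneg_left (norm_le_pi_norm b j) (hP i j)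
      _ = ‖b‖ := by rw [← Finset.sum_mul, hrow, one_mul]

lemma summable_Pv (P : Matrix (Fin d) (Fin d) ℝ) (hP : ∀ i j, 0 ≤ P i j) (hrow : ∀ i, ∑ j, P i j = 1)
    (a : Fin d → ℝ) {c : ℝ} (hc0 : 0 ≤ c) (hc : c < 1) (k : ℕ) :
    Summable fun m : ℕ => c ^ m • (P ^ (m + k) *ᵥ a) := by
  refine Summable.of_norm_bounded (g := fun m => c ^ m * ‖a‖)
    ((summable_geometric_of_lt_one hc0 hc).mul_right _) fun m => ?_
  rw [norm_smul, Real.norm_of_nonneg (pow_nonneg hc0 m)]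
  exact mul_le_mul_of_nonneg_left (sup_P P hP hrow a _) (pow_nonneg hc0 m)

lemma summable_P (P : Matrix (Fin d) (Fin d) ℝ) (hP : ∀ i j, 0 ≤ P i j) (hrow : ∀ i, ∑ j, P i j = 1)
    {c : ℝ} (hc0 : 0 ≤ c) (hc : c < 1) :
    Summable fun m : ℕ => c ^ m • P ^ (m + 1) := by
  refine Pi.summable.2 fun i => Pi.summable.2 fun j => ?_
  have := Pi.summable.1 (summable_Pv P hP hrow (Pi.single j 1) hc0 hc 1) i
  simpa using this

lemma Plam_mulVec (P : Matrix (Fin d) (Fin d) ℝ) (hP : ∀ i j, 0 ≤ P i j) (hrow : ∀ i, ∑ j, P i j = 1)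
    {γ lam : ℝ} (hγ0 : 0 < γ) (hγ1 : γ < 1) (hlam0 : 0 ≤ lam) (hlam1 : lam < 1) (a : Fin d → ℝ) :
    Plam P γ lam *ᵥ a = (1 - lam) • ∑' m : ℕ, (lam * γ) ^ m • (P ^ (m + 1) *ᵥ a) := by
  have hs := (summable_P P hP hrow (c := lam * γ) (by positivity) (by nlinarith)).hasSum
  have := hs.map ((Matrix.mulVecBilin ℝ ℝ).flip a : Matrix (Fin d) (Fin d) ℝ →ₗ[ℝ] (Fin d → ℝ))
    (LinearMap.continuous_of_finiteDimensional _)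
  rw [Plam, Matrix.smul_mulVec]
  congr 1
  refine (HasSum.tsum_eq this).symm.trans ?_
  congr 1; ext1 m; exact Matrix.smul_mulVec ((lam * γ) ^ m) (P ^ (m + 1)) a

lemma muNorm_Plam (P : Matrix (Fin d) (Fin d) ℝ) (hP : ∀ i j, 0 ≤ P i j) (hrow : ∀ i, ∑ j, P i j = 1)
    (hinv : ∀ j, ∑ i, μ i * P i j = μ j) (hμ : ∀ i, 0 < μ i)
    {γ lam : ℝ} (hγ0 : 0 < γ) (hγ1 : γ < 1) (hlam0 : 0 ≤ lam) (hlam1 : lam < 1) (a : Fin d → ℝ) :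
    muNorm μ (Plam P γ lam *ᵥ a) ≤ muNorm μ a := by
  rw [Plam_mulVec P hP hrow hγ0 hγ1 hlam0 hlam1, muNorm_smul hμ, abs_of_pos (by linarith)]
  have hc0 : 0 ≤ lam * γ := by positivity
  have hc1 : lam * γ < 1 := by nlinarith
  let Φ : (Fin d → ℝ) →ₗ[ℝ] EuclideanSpace ℝ (Fin d) :=
    { toFun := fun a => WithLp.toLp 2 (sm μ a)
      map_add' := fun a b => by ext i; simp [sm]; ring
      map_smul' := fun a b => by ext i; simp [sm]; ring }
  have hΦ : ∀ b, muNorm μ b = ‖Φ b‖ := fun b => by rw [muNorm_eq hμ, eNorm_eq]; rfl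
  have hs := (summable_Pv P hP hrow a hc0 hc1 1).hasSum.map Φ
    (LinearMap.continuous_of_finiteDimensional _)
  have hb : muNorm μ (∑' m : ℕ, (lam * γ) ^ m • (P ^ (m + 1) *ᵥ a))
      ≤ (1 - lam * γ)⁻¹ * muNorm μ a := by
    rw [hΦ, ← hs.tsum_eq]
    refine tsum_of_norm_bounded ((hasSum_geometric_of_lt_one hc0 hc1).mul_right _) fun m => ?_
    rw [Function.comp_apply, ← hΦ, muNorm_smul hμ, abs_of_nonneg (pow_nonneg hc0 m)]
    exact mul_le_mul_of_nonneg_left (muNorm_Ppow P hP hrow hinv hμ _ _) (pow_nonneg hc0 m)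
  calc _ ≤ (1 - lam) * ((1 - lam * γ)⁻¹ * muNorm μ a) :=
        mul_le_mul_of_nonneg_left hb (by linarith)
    _ = ((1 - lam) / (1 - lam * γ)) * muNorm μ a := by ring
    _ ≤ 1 * muNorm μ a := by
        apply mul_le_mul_of_nonneg_right _ (muNorm_nonneg _)
        rw [div_le_one (by linarith)]; nlinarith
    _ = _ := one_mul _

lemma Tlam_Vstar (P : Matrix (Fin d) (Fin d) ℝ) (hP : ∀ i j, 0 ≤ P i j) (hrow : ∀ i, ∑ j, P i j = 1)
    {γ lam : ℝ} (hγ0 : 0 < γ) (hγ1 : γ < 1) (hlam0 : 0 ≤ lam) (hlam1 : lam < 1) (rbar : Fin d → ℝ) :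
    Tlam P γ lam rbar (Vstar P γ rbar) = Vstar P γ rbar := by
  set v := Vstar P γ rbar with hv
  have hc0 : 0 ≤ lam * γ := by positivity
  have hc1 : lam * γ < 1 := by nlinarith
  have hsr := summable_Pv P hP hrow rbar hγ0.le hγ1 0
  simp only [add_zero] at hsr
  have hsplit : ∀ m : ℕ, v = (∑ t ∈ Finset.range (m + 1), γ ^ t • (P ^ t) *ᵥ rbar)
      + γ ^ (m + 1) • (P ^ (m + 1) *ᵥ v) := by
    intro m
    rw [hv, Vstar, ← hsr.sum_add_tsum_nat_add (m + 1)]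
    congr 1
    rw [hsr.sum_add_tsum_nat_add (m + 1)]
    have := hsr.hasSum.map (Matrix.mulVecLin (P ^ (m + 1)))
      (LinearMap.continuous_of_finiteDimensional _)
    have h2 := (this.const_smul (γ ^ (m + 1))).tsum_eq
    rw [Matrix.mulVecLin_apply] at h2
    rw [← h2]
    congr 1; ext1 t
    rw [Function.comp_apply, Matrix.mulVecLin_apply, Matrix.mulVec_smul, smul_smul,
      Matrix.mulVec_mulVec, ← pow_add, ← pow_add, add_comm t]
  have hs1 : HasSum (fun m : ℕ => lam ^ m • v) ((1 - lam)⁻¹ • v) :=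
    (hasSum_geometric_of_lt_one hlam0 hlam1).smul_const v
  have hs2 := (summable_Pv P hP hrow v hc0 hc1 1).hasSum.const_smul γ
  have hs3 := hs1.sub hs2
  have he : (fun m : ℕ => lam ^ m • v - γ • (lam * γ) ^ m • (P ^ (m + 1) *ᵥ v))
      = fun m => lam ^ m • (∑ t ∈ Finset.range (m + 1), γ ^ t • (P ^ t) *ᵥ rbar) := by
    ext1 m
    have := hsplit m
    rw [sub_eq_iff_eq_add]
    conv_lhs => rw [this]
    rw [smul_add, smul_smul, smul_smul, mul_pow]
    congr 2; ring
  rw [he] at hs3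
  rw [Tlam, rlam, hs3.tsum_eq, Plam_mulVec P hP hrow hγ0 hγ1 hlam0 hlam1, smul_sub, smul_smul,
    mul_inv_cancel₀ (by linarith), one_smul, smul_comm γ]
  abel

end mu
end helpers
section dyn

lemma toLp_deriv {n : ℕ} {f : ℝ → Fin n → ℝ} {f' : Fin n → ℝ} {t : ℝ} (h : HasDerivAt f f' t) :
    HasDerivAt (fun s => WithLp.toLp 2 (f s)) (WithLp.toLp 2 f') t :=
  ((PiLp.continuousLinearEquiv 2 ℝ (fun _ : Fin n => ℝ)).symm.hasFDerivAt).comp_hasDerivAt t h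

lemma mulVec_deriv {n m : ℕ} (B : Matrix (Fin m) (Fin n) ℝ)
    {f : ℝ → Fin n → ℝ} {f' : Fin n → ℝ} {t : ℝ} (h : HasDerivAt f f' t) :
    HasDerivAt (fun s => B *ᵥ f s) (B *ᵥ f') t :=
  ((LinearMap.toContinuousLinearMap (Matrix.mulVecLin B)).hasFDerivAt).comp_hasDerivAt t h

lemma dot_self_deriv {n : ℕ}
    {f : ℝ → Fin n → ℝ} {f' : Fin n → ℝ} {t : ℝ} (h : HasDerivAt f f' t) :
    HasDerivAt (fun s => f s ⬝ᵥ f s) (2 * (f t ⬝ᵥ f')) t := by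
  have h1 := hasDerivAt_pi.1 h
  have h2 : HasDerivAt (fun s => ∑ i, f s i * f s i) (∑ i, (f' i * f t i + f t i * f' i)) t :=
    HasDerivAt.fun_sum fun i _ => (h1 i).mul (h1 i)
  have h3 : 2 * (f t ⬝ᵥ f') = ∑ i, (f' i * f t i + f t i * f' i) := by
    simp only [dotProduct, Finset.mul_sum]
    exact Finset.sum_congr rfl fun i _ => by ring
  rw [h3]
  exact h2

lemma rem_bound {d p : ℕ} (V : (Fin p → ℝ) → (Fin d → ℝ))
    (DV : (Fin p → ℝ) → Matrix (Fin d) (Fin p) ℝ)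
    (hV : ∀ v, HasFDerivAt V (LinearMap.toContinuousLinearMap (Matrix.mulVecLin (DV v))) v)
    (L : ℝ) (hL : 0 < L)
    (hLip : ∀ v v', matOpNorm (DV v - DV v') ≤ L * eNorm (v - v'))
    (w₀ x : Fin p → ℝ) :
    eNorm (V (w₀ + x) - V w₀ - DV w₀ *ᵥ x) ≤ L * eNorm x ^ 2 := by
  have hd : ∀ s : ℝ, HasDerivAt (fun s : ℝ => V (w₀ + s • x) - s • (DV w₀ *ᵥ x))
      ((DV (w₀ + s • x)) *ᵥ x - DV w₀ *ᵥ x) s := by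
    intro s
    have h1 : HasDerivAt (fun s : ℝ => w₀ + s • x) x s := by
      simpa using ((hasDerivAt_id s).smul_const x).const_add w₀
    have h2 := (hV (w₀ + s • x)).comp_hasDerivAt s h1
    have h3 : HasDerivAt (fun s : ℝ => s • (DV w₀ *ᵥ x)) (DV w₀ *ᵥ x) s := by
      simpa using (hasDerivAt_id s).smul_const (DV w₀ *ᵥ x)
    exact h2.sub h3
  have := norm_image_sub_le_of_norm_deriv_le_segment_01'
    (f := fun s : ℝ => WithLp.toLp 2 (V (w₀ + s • x) - s • (DV w₀ *ᵥ x)))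
    (C := L * eNorm x ^ 2)
    (fun s _ => (toLp_deriv (hd s)).hasDerivWithinAt) (fun s hs => by
      rw [← eNorm_eq, ← Matrix.sub_mulVec]
      have hh := hLip (w₀ + s • x) w₀
      rw [add_sub_cancel_left, eNorm_smul, abs_of_nonneg hs.1] at hh
      have hx := eNorm_nonneg x
      calc _ ≤ _ := eNorm_mulVec_le _ _
        _ ≤ (L * (s * eNorm x)) * eNorm x := mul_le_mul_of_nonneg_right hh hx
        _ = s * (L * eNorm x ^ 2) := by ring
        _ ≤ 1 * (L * eNorm x ^ 2) := mul_le_mul_of_nonneg_right hs.2.le (by positivity)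
        _ = _ := one_mul _)
  rw [← WithLp.toLp_sub, ← eNorm_eq] at this
  refine le_of_eq_of_le ?_ this
  congr 1
  simp only [one_smul, zero_smul, add_zero, sub_zero]
  abel

lemma kernel_abs {E : Type*} [NormedAddCommGroup E] [NormedSpace ℝ E]
    {k k' : ℝ → E} {q q' m : ℝ → ℝ} {T κ δ c : ℝ} (hT : 0 ≤ T) (hκ : 1 ≤ κ) (hδ : 0 < δ) (hc : 0 ≤ c)
    (hk0 : k 0 = 0)
    (hk : ∀ s ∈ Set.Icc 0 T, HasDerivAt k (k' s) s)
    (hk' : ∀ s ∈ Set.Icc 0 T, ‖k' s‖ ≤ c * m s)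
    (hq : ∀ s ∈ Set.Icc 0 T, HasDerivAt q (q' s) s)
    (hq' : ∀ s ∈ Set.Icc 0 T, q' s ≤ - δ * m s ^ 2)
    (hq0 : ∀ s, 0 ≤ q s) (hm0 : ∀ s, 0 ≤ m s)
    (hqm : ∀ s, q s ≤ κ ^ 2 * m s ^ 2) :
    ‖k T‖ ≤ c * (2 * κ / δ * Real.sqrt (q 0)) := by
  have main : ∀ η : ℝ, 0 < η →
      ‖k T‖ ≤ c * (η * T + 2 * κ / δ * (Real.sqrt (q 0) + η)) := by
    intro η hη
    let N : ℝ → ℝ := fun s => Real.sqrt (q s + η ^ 2)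
    have hpos : ∀ s, 0 < q s + η ^ 2 := fun s => by have := hq0 s; positivity
    have hNpos : ∀ s, 0 < N s := fun s => Real.sqrt_pos.2 (hpos s)
    have hN : ∀ s ∈ Set.Icc 0 T, HasDerivAt N (q' s / (2 * N s)) s := fun s hs =>
      ((hq s hs).add_const (η ^ 2)).sqrt (hpos s).ne'
    have hNup : ∀ s, N s ≤ Real.sqrt (q s) + η := fun s => by
      apply Real.sqrt_le_iff.2
      have h1 := Real.sqrt_nonneg (q s)
      have h2 := Real.sq_sqrt (hq0 s)
      exact ⟨by positivity, by nlinarith⟩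
    have hNup2 : ∀ s, N s ≤ κ * m s + η := fun s => by
      refine (hNup s).trans ?_
      have h3 : Real.sqrt (q s) ≤ κ * m s := by
        apply Real.sqrt_le_iff.2
        have := hm0 s
        exact ⟨by positivity, by have := hqm s; nlinarith⟩
      linarith
    let B : ℝ → ℝ := fun s => c * (η * s + 2 * κ / δ * (N 0 - N s))
    let B' : ℝ → ℝ := fun s => c * (η * 1 + 2 * κ / δ * (0 - q' s / (2 * N s)))
    have hB : ∀ s ∈ Set.Icc 0 T, HasDerivAt B (B' s) s := fun s hs =>
      (((hasDerivAt_id s).const_mul η).add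
        (((hasDerivAt_const s (N 0)).sub (hN s hs)).const_mul (2 * κ / δ))).const_mul c
    have hkey : ∀ s ∈ Set.Icc 0 T, ‖k' s‖ ≤ B' s := by
      intro s hs
      refine (hk' s hs).trans (mul_le_mul_of_nonneg_left ?_ hc)
      have h1 := hq' s hs
      have h2 := hNup2 s
      have h3 := hNpos s
      have h4 := hm0 s
      have h5 : 2 * κ / δ * (0 - q' s / (2 * N s)) = κ * (- q' s) / (δ * N s) := by
        field_simp; ring
      rw [h5]
      have h6 : κ * (δ * m s ^ 2) / (δ * N s) ≤ κ * (- q' s) / (δ * N s) := by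
        apply div_le_div_of_nonneg_right _ (by positivity)
        apply mul_le_mul_of_nonneg_left _ (by linarith)
        linarith
      have h7 : m s - η ≤ κ * (δ * m s ^ 2) / (δ * N s) := by
        rw [le_div_iff₀ (by positivity)]
        rcases le_total (m s) η with h | h
        · have : (m s - η) * (δ * N s) ≤ 0 :=
            mul_nonpos_of_nonpos_of_nonneg (by linarith) (by positivity)
          have : 0 ≤ κ * (δ * m s ^ 2) := by positivity
          linarith
        · have e1 : (m s - η) * N s ≤ (m s - η) * (κ * m s + η) :=
            mul_le_mul_of_nonneg_left h2 (by linarith)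
          have e2 : (m s - η) * (κ * m s + η) ≤ κ * m s ^ 2 := by
            nlinarith [mul_nonneg (mul_nonneg h4 hη.le) (sub_nonneg.2 hκ), sq_nonneg η]
          nlinarith
      linarith
    have := image_norm_le_of_norm_deriv_right_le_deriv_boundary' (a := 0) (b := T) (f := k) (f' := k')
      (fun s hs => (hk s hs).continuousAt.continuousWithinAt)
      (fun s hs => (hk s ⟨hs.1, hs.2.le⟩).hasDerivWithinAt) (B := B) (B' := B')
      (by simp [hk0, B])
      (fun s hs => (hB s hs).continuousAt.continuousWithinAt)
      (fun s hs => (hB s ⟨hs.1, hs.2.le⟩).hasDerivWithinAt)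
      (fun s hs => hkey s ⟨hs.1, hs.2.le⟩) (x := T) ⟨hT, le_rfl⟩
    refine this.trans (mul_le_mul_of_nonneg_left ?_ hc)
    have h1 := hNup 0
    have h2 := hNpos T
    have h3 : 2 * κ / δ * (N 0 - N T) ≤ 2 * κ / δ * (Real.sqrt (q 0) + η) :=
      mul_le_mul_of_nonneg_left (by linarith) (by positivity)
    linarith
  have hlim : Filter.Tendsto (fun η : ℝ => c * (η * T + 2 * κ / δ * (Real.sqrt (q 0) + η)))
      (nhdsWithin 0 (Set.Ioi 0)) (nhds (c * (0 * T + 2 * κ / δ * (Real.sqrt (q 0) + 0)))) := by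
    apply Filter.Tendsto.mono_left _ nhdsWithin_le_nhds
    apply Continuous.tendsto (by fun_prop)
  have := ge_of_tendsto hlim (Filter.eventually_of_mem self_mem_nhdsWithin fun η hη => main η hη)
  simpa using this

variable {d p : ℕ} {A : Matrix (Fin d) (Fin p) ℝ} {σ : ℝ} {μ : Fin d → ℝ} {κ : ℝ}

lemma dot_Gam (a g : Fin d → ℝ) : a ⬝ᵥ ((Matrix.diagonal μ) *ᵥ g) = muInner μ a g := by
  simp only [dotProduct, Matrix.mulVec_diagonal, muInner]
  exact Finset.sum_congr rfl fun i _ => by ring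

lemma Gam_le (hσ : 0 < σ) (hu : IsUnit (A * Aᵀ).det)
    (h : ∀ u : Fin d → ℝ, σ * eNorm u ≤ eNorm (Aᵀ.mulVec u)) (hμ : ∀ i, 0 < μ i) (hκ : 1 ≤ κ)
    (hκ2 : ∀ f : Fin d → ℝ, muNorm μ f ≤ κ * norm0 A f) (g : Fin d → ℝ) :
    eNorm ((Matrix.diagonal μ) *ᵥ g) ≤ κ / σ * muNorm μ g := by
  have hg := muNorm_nonneg (μ := μ) g
  apply eNorm_le_of (by positivity)
  rw [dot_Gam]
  set y := (Matrix.diagonal μ) *ᵥ g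
  calc _ ≤ muNorm μ y * muNorm μ g := muInner_le hμ _ _
    _ ≤ (κ * (eNorm y / σ)) * muNorm μ g := by
      apply mul_le_mul_of_nonneg_right _ hg
      exact (hκ2 y).trans (mul_le_mul_of_nonneg_left (norm0_le hσ hu h y) (by linarith))
    _ = _ := by ring

/-- pointwise energy estimate -/
lemma energy_pt (hσ : 0 < σ) (hu : IsUnit (A * Aᵀ).det)
    (h : ∀ u : Fin d → ℝ, σ * eNorm u ≤ eNorm (Aᵀ.mulVec u)) (hμ : ∀ i, 0 < μ i) (hκ : 1 ≤ κ)
    (hκ1 : ∀ f : Fin d → ℝ, norm0 A f ≤ κ * muNorm μ f)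
    (hκ2 : ∀ f : Fin d → ℝ, muNorm μ f ≤ κ * norm0 A f)
    {δ : ℝ} (B : Matrix (Fin d) (Fin p) ℝ) (e g : Fin d → ℝ)
    (hA : 0 < matOpNorm A)
    (hB : matOpNorm (B - A) ≤ δ * σ ^ 2 / (12 * κ ^ 2 * matOpNorm A))
    (hBA : matOpNorm (B - A) ≤ matOpNorm A)
    (hg : muNorm μ g ≤ 2 * muNorm μ e)
    (heg : muInner μ e g ≤ - δ * muNorm μ e ^ 2) :
    2 * inner0 A e (B *ᵥ (Bᵀ *ᵥ ((Matrix.diagonal μ) *ᵥ g))) ≤ - δ * muNorm μ e ^ 2 := by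
  set y := (Matrix.diagonal μ) *ᵥ g with hy
  set D := B - A with hD
  set a := matOpNorm A
  set r := matOpNorm D
  have hr : 0 ≤ r := matOpNorm_nonneg _
  have hyle := Gam_le hσ hu h hμ hκ hκ2 g
  rw [← hy] at hyle
  have hy0 := eNorm_nonneg y
  have hBD : B = A + D := by simp [hD]
  have hdec : B *ᵥ (Bᵀ *ᵥ y) = A *ᵥ (Aᵀ *ᵥ y) +
      (D *ᵥ (Aᵀ *ᵥ y) + D *ᵥ (Dᵀ *ᵥ y) + A *ᵥ (Dᵀ *ᵥ y)) := by
    rw [hBD, Matrix.transpose_add]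
    simp only [Matrix.add_mulVec, Matrix.mulVec_add]
    abel
  have hmain : inner0 A e (A *ᵥ (Aᵀ *ᵥ y)) = muInner μ e g := by
    rw [inner0_eq hu, JJ_A hu, dot_mulVec_T, A_JJ hu, hy, dot_Gam]
  set z := D *ᵥ (Aᵀ *ᵥ y) + D *ᵥ (Dᵀ *ᵥ y) + A *ᵥ (Dᵀ *ᵥ y) with hz
  have hzle : eNorm z ≤ 3 * (r * a) * eNorm y := by
    have e1 : eNorm (D *ᵥ (Aᵀ *ᵥ y)) ≤ r * (a * eNorm y) :=
      (eNorm_mulVec_le _ _).trans (mul_le_mul_of_nonneg_left (eNorm_mulVec_T_le _ _) hr)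
    have e2 : eNorm (D *ᵥ (Dᵀ *ᵥ y)) ≤ r * (r * eNorm y) :=
      (eNorm_mulVec_le _ _).trans (mul_le_mul_of_nonneg_left (eNorm_mulVec_T_le _ _) hr)
    have e3 : eNorm (A *ᵥ (Dᵀ *ᵥ y)) ≤ a * (r * eNorm y) :=
      (eNorm_mulVec_le _ _).trans (mul_le_mul_of_nonneg_left (eNorm_mulVec_T_le _ _) hA.le)
    have e4 : r * (r * eNorm y) ≤ r * (a * eNorm y) :=
      mul_le_mul_of_nonneg_left (mul_le_mul_of_nonneg_right hBA hy0) hr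
    have e5 := eNorm_add_le (D *ᵥ (Aᵀ *ᵥ y) + D *ᵥ (Dᵀ *ᵥ y)) (A *ᵥ (Dᵀ *ᵥ y))
    have e6 := eNorm_add_le (D *ᵥ (Aᵀ *ᵥ y)) (D *ᵥ (Dᵀ *ᵥ y))
    rw [← hz] at e5
    nlinarith
  have hadd : inner0 A e (A *ᵥ (Aᵀ *ᵥ y) + z) = muInner μ e g + inner0 A e z := by
    rw [← hmain, inner0_eq hu, inner0_eq hu, inner0_eq hu, JJ_add, dotProduct_add]
  have hsym : inner0 A e z = z ⬝ᵥ ((A * Aᵀ)⁻¹ *ᵥ e) := by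
    rw [inner0_eq hu, dotProduct_comm, ← inner0_eq hu]; rfl
  set m := muNorm μ e
  have hm : 0 ≤ m := muNorm_nonneg _
  have hG : eNorm ((A * Aᵀ)⁻¹ *ᵥ e) ≤ κ * m / σ := by
    rw [le_div_iff₀ hσ, mul_comm]
    exact (eNorm_G_le hu h e).trans (hκ1 e)
  have herr : inner0 A e z ≤ δ / 2 * m ^ 2 := by
    rw [hsym]
    have hyle2 : eNorm y ≤ κ / σ * (2 * m) :=
      hyle.trans (mul_le_mul_of_nonneg_left hg (by positivity))
    calc _ ≤ eNorm z * eNorm ((A * Aᵀ)⁻¹ *ᵥ e) := (le_abs_self _).trans (dot_le _ _)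
      _ ≤ (3 * (r * a) * (κ / σ * (2 * m))) * (κ * m / σ) := by
        apply mul_le_mul (hzle.trans (mul_le_mul_of_nonneg_left hyle2 (by positivity))) hG
          (eNorm_nonneg _) (by positivity)
      _ = r * (6 * a * κ ^ 2 / σ ^ 2 * m ^ 2) := by ring
      _ ≤ (δ * σ ^ 2 / (12 * κ ^ 2 * a)) * (6 * a * κ ^ 2 / σ ^ 2 * m ^ 2) :=
        mul_le_mul_of_nonneg_right hB (by positivity)
      _ = δ / 2 * m ^ 2 := by
        have : κ ≠ 0 := by positivity
        field_simp; ring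
  rw [hdec, hadd]
  linarith

/-- pointwise bound of the kernel part of the velocity -/
lemma kernel_pt (hσ : 0 < σ) (hu : IsUnit (A * Aᵀ).det)
    (h : ∀ u : Fin d → ℝ, σ * eNorm u ≤ eNorm (Aᵀ.mulVec u)) (hμ : ∀ i, 0 < μ i) (hκ : 1 ≤ κ)
    (hκ2 : ∀ f : Fin d → ℝ, muNorm μ f ≤ κ * norm0 A f)
    (B : Matrix (Fin d) (Fin p) ℝ) (e g : Fin d → ℝ) {ρ : ℝ}
    (hB : matOpNorm (B - A) ≤ ρ)
    (hg : muNorm μ g ≤ 2 * muNorm μ e) :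
    eNorm (QQ A (Bᵀ *ᵥ ((Matrix.diagonal μ) *ᵥ g))) ≤ 2 * ρ * κ / σ * muNorm μ e := by
  set y := (Matrix.diagonal μ) *ᵥ g with hy
  have hyle := Gam_le hσ hu h hμ hκ hκ2 g
  rw [← hy] at hyle
  have hρ : 0 ≤ ρ := (matOpNorm_nonneg _).trans hB
  have : Bᵀ *ᵥ y = (B - A)ᵀ *ᵥ y + Aᵀ *ᵥ y := by
    rw [← Matrix.add_mulVec, ← Matrix.transpose_add]; simp
  rw [this, QQ_add_T hu]
  calc _ ≤ _ := eNorm_QQ_le hu _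
    _ ≤ _ := eNorm_mulVec_T_le _ _
    _ ≤ ρ * (κ / σ * (2 * muNorm μ e)) :=
      mul_le_mul hB (hyle.trans (mul_le_mul_of_nonneg_left hg (by positivity)))
        (eNorm_nonneg _) hρ
    _ = _ := by ring

lemma QQ_deriv {f : ℝ → Fin p → ℝ} {f' : Fin p → ℝ} {t : ℝ} (h : HasDerivAt f f' t) :
    HasDerivAt (fun s => QQ A (f s)) (QQ A f') t :=
  h.sub (mulVec_deriv _ (mulVec_deriv _ (mulVec_deriv _ h)))

lemma inner0_deriv (hu : IsUnit (A * Aᵀ).det) {f : ℝ → Fin d → ℝ} {f' : Fin d → ℝ} {t : ℝ}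
    (h : HasDerivAt f f' t) :
    HasDerivAt (fun s => inner0 A (f s) (f s)) (2 * inner0 A (f t) f') t := by
  simp only [inner0_eq hu]
  exact dot_self_deriv (f := fun s => JJ A (f s)) (mulVec_deriv _ (mulVec_deriv _ h))

end dyn

set_option maxHeartbeats 2000000 in
/-- Over-parametrized lazy TD learning: lazy weights. Under the hypotheses of the
over-parametrized convergence theorem, if moreover ‖V_{w₀}‖₀ ≤ C α⁻¹ for some C > 0,
then ‖w(t) − w₀‖₂ ≤ (4κ²/(α(1−γ))) ‖DV₀‖ (C + ‖V*‖₀) for all t ≥ 0; in particular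
sup_{t≥0} ‖w(t) − w₀‖₂ = O(α⁻¹). -/
theorem overparametrized_lazy_TD_lazy_weights
    {d p : ℕ} (hd : 0 < d)
    (P : Matrix (Fin d) (Fin d) ℝ)
    (hP_nonneg : ∀ i j, 0 ≤ P i j)
    (hP_row : ∀ i, ∑ j, P i j = 1)
    (μ : Fin d → ℝ)
    (hμ_pos : ∀ i, 0 < μ i)
    (hμ_sum : ∑ i, μ i = 1)
    (hμ_inv : ∀ j, ∑ i, μ i * P i j = μ j)
    (γ lam : ℝ) (hγ0 : 0 < γ) (hγ1 : γ < 1) (hlam0 : 0 ≤ lam) (hlam1 : lam < 1)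
    (rbar : Fin d → ℝ)
    (V : (Fin p → ℝ) → (Fin d → ℝ))
    (DV : (Fin p → ℝ) → Matrix (Fin d) (Fin p) ℝ)
    (hV : ∀ v, HasFDerivAt V (LinearMap.toContinuousLinearMap (Matrix.mulVecLin (DV v))) v)
    (L : ℝ) (hL : 0 < L)
    (hLip : ∀ v v', matOpNorm (DV v - DV v') ≤ L * eNorm (v - v'))
    (w₀ : Fin p → ℝ)
    (σmin : ℝ) (hσ : 0 < σmin)
    (hσmin : ∀ u : Fin d → ℝ, σmin * eNorm u ≤ eNorm ((DV w₀)ᵀ.mulVec u))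
    (hσsmall : ∀ σ' : ℝ, (∀ u : Fin d → ℝ, σ' * eNorm u ≤ eNorm ((DV w₀)ᵀ.mulVec u)) → σ' ≤ σmin)
    (κ : ℝ) (hκ : 1 ≤ κ)
    (hκequiv : ∀ f : Fin d → ℝ,
      κ⁻¹ * norm0 (DV w₀) f ≤ muNorm μ f ∧ muNorm μ f ≤ κ * norm0 (DV w₀) f)
    (α : ℝ)
    (hM : norm0 (DV w₀) (V w₀)
      < (1 - γ) ^ 2 * σmin ^ 2 / (192 * κ ^ 2 * L * matOpNorm (DV w₀)))
    (hα : α > norm0 (DV w₀) (Vstar P γ rbar)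
      / ((1 - γ) ^ 2 * σmin ^ 2 / (192 * κ ^ 2 * L * matOpNorm (DV w₀))))
    (w : ℝ → (Fin p → ℝ))
    (hw0 : w 0 = w₀)
    (hODE : ∀ t : ℝ, 0 ≤ t →
      HasDerivAt w
        ((1 / α) • ((DV (w t))ᵀ.mulVec
          ((Matrix.diagonal μ).mulVec
            (Tlam P γ lam rbar (α • V (w t)) - α • V (w t))))) t)
    (C : ℝ) (hC : 0 < C)
    (hVC : norm0 (DV w₀) (V w₀) ≤ C / α) :
    ∀ t : ℝ, 0 ≤ t →
      eNorm (w t - w₀)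
        ≤ (4 * κ ^ 2 / (α * (1 - γ))) * matOpNorm (DV w₀)
            * (C + norm0 (DV w₀) (Vstar P γ rbar)) := by
  set A := DV w₀ with hAdef
  set a := matOpNorm A with ha
  set δ := 1 - γ with hδdef
  set Vs := Vstar P γ rbar with hVs
  have hδ : 0 < δ := by rw [hδdef]; linarith
  have hδ1 : δ < 1 := by rw [hδdef]; linarith
  have hκ0 : 0 < κ := by linarith
  have hu : IsUnit (A * Aᵀ).det := G_unit hσ hσmin
  have hκ2 : ∀ f : Fin d → ℝ, muNorm μ f ≤ κ * norm0 A f := fun f => (hκequiv f).2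
  have hκ1 : ∀ f : Fin d → ℝ, norm0 A f ≤ κ * muNorm μ f := fun f => by
    have := (hκequiv f).1
    rwa [inv_mul_le_iff₀ hκ0] at this
  -- the size of A
  let u : Fin d → ℝ := fun _ => 1
  have hupos : 0 < eNorm u := by
    refine Real.sqrt_pos.2 ?_
    simp [u, hd]
  have hσa : σmin ≤ a := by
    have := (hσmin u).trans (eNorm_mulVec_T_le A u)
    exact le_of_mul_le_mul_right this hupos
  have ha0 : 0 < a := hσ.trans_le hσa
  have hκa : 1 ≤ κ * a := by
    have h1 := eNorm_le_norm0 hu u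
    have h2 := hκ1 u
    have h3 := muNorm_le_eNorm hμ_pos hμ_sum u
    have h4 : 1 * eNorm u ≤ (κ * a) * eNorm u := by
      calc 1 * eNorm u ≤ a * norm0 A u := by rw [one_mul]; exact h1
        _ ≤ a * (κ * eNorm u) := mul_le_mul_of_nonneg_left
            (h2.trans (mul_le_mul_of_nonneg_left h3 hκ0.le)) ha0.le
        _ = _ := by ring
    exact le_of_mul_le_mul_right h4 hupos
  set M := δ ^ 2 * σmin ^ 2 / (192 * κ ^ 2 * L * a) with hMdef
  have hM0 : 0 < M := by positivity
  have hVs0 : 0 ≤ norm0 A Vs := norm0_nonneg _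
  have hα0 : 0 < α := lt_of_le_of_lt (by positivity) hα
  have hVsM : norm0 A Vs < α * M := by rwa [gt_iff_lt, div_lt_iff₀ hM0] at hα
  -- error and velocity
  let e : ℝ → Fin d → ℝ := fun t => α • V (w t) - Vs
  let g : ℝ → Fin d → ℝ := fun t => Tlam P γ lam rbar (α • V (w t)) - α • V (w t)
  have hge : ∀ t, g t = γ • (Plam P γ lam *ᵥ e t) - e t := by
    intro t
    have h1 := Tlam_Vstar P hP_nonneg hP_row hγ0 hγ1 hlam0 hlam1 rbar
    rw [← hVs, Tlam] at h1
    simp only [g, e, Tlam, Matrix.mulVec_sub, smul_sub]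
    have h2 : rlam P γ lam rbar = Vs - γ • Plam P γ lam *ᵥ Vs := eq_sub_of_add_eq h1
    rw [h2]; abel
  have hPl : ∀ t, muNorm μ (γ • (Plam P γ lam *ᵥ e t)) ≤ γ * muNorm μ (e t) := by
    intro t
    rw [muNorm_smul hμ_pos, abs_of_pos hγ0]
    exact mul_le_mul_of_nonneg_left
      (muNorm_Plam P hP_nonneg hP_row hμ_inv hμ_pos hγ0 hγ1 hlam0 hlam1 _) hγ0.le
  have hg2 : ∀ t, muNorm μ (g t) ≤ 2 * muNorm μ (e t) := by
    intro t
    have h1 := hPl t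
    have h2 := muNorm_nonneg (μ := μ) (e t)
    rw [hge]
    refine (muNorm_sub_le hμ_pos _ _).trans ?_
    nlinarith
  have heg : ∀ t, muInner μ (e t) (g t) ≤ - δ * muNorm μ (e t) ^ 2 := by
    intro t
    have h1 := hPl t
    have h2 := muNorm_nonneg (μ := μ) (e t)
    have h3 := muInner_le hμ_pos (e t) (γ • (Plam P γ lam *ᵥ e t))
    have h4 : muInner μ (e t) (g t)
        = muInner μ (e t) (γ • (Plam P γ lam *ᵥ e t)) - muInner μ (e t) (e t) := by
      rw [hge]
      simp only [muInner, ← Finset.sum_sub_distrib]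
      exact Finset.sum_congr rfl fun i _ => by rw [Pi.sub_apply]; ring
    rw [h4, muNorm_sq hμ_pos, hδdef]
    nlinarith
  have hwd : ∀ t, 0 ≤ t → HasDerivAt w
      ((1 / α) • ((DV (w t))ᵀ *ᵥ (Matrix.diagonal μ *ᵥ g t))) t := hODE
  have hed : ∀ t, 0 ≤ t → HasDerivAt e
      (DV (w t) *ᵥ ((DV (w t))ᵀ *ᵥ (Matrix.diagonal μ *ᵥ g t))) t := by
    intro t ht
    have h1 := (((hV (w t)).comp_hasDerivAt t (hwd t ht)).const_smul α).sub_const Vs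
    rw [LinearMap.coe_toContinuousLinearMap', Matrix.mulVecLin_apply, Matrix.mulVec_smul, smul_smul,
      mul_one_div_cancel hα0.ne', one_smul] at h1
    exact h1
  set E0 := norm0 A (e 0) with hE0
  have hE0nn : 0 ≤ E0 := norm0_nonneg _
  have hE0le : E0 ≤ α * norm0 A (V w₀) + norm0 A Vs := by
    have := norm0_sub_le hu (α • V (w 0)) Vs
    rw [norm0_smul hu, abs_of_pos hα0, hw0] at this
    simpa only [hE0, e, hw0] using this
  have hE0M : E0 < 2 * α * M := by nlinarith
  have hE0C : E0 ≤ C + norm0 A Vs := by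
    rw [le_div_iff₀ hα0] at hVC
    linarith
  let R : ℝ → ℝ := fun t => eNorm (w t - w₀)
  have hR0 : R 0 = 0 := by simp [R, hw0, eNorm]
  have hRnn : ∀ t, 0 ≤ R t := fun t => eNorm_nonneg _
  set R₀ := δ * σmin ^ 2 / (12 * κ ^ 2 * L * a) with hR₀
  have hR₀pos : 0 < R₀ := by positivity
  have hMR : 16 * M = δ * R₀ := by rw [hMdef, hR₀]; field_simp; norm_num
  have hLR : L * R₀ = δ * σmin ^ 2 / (12 * κ ^ 2 * a) := by rw [hR₀]; field_simp
  have hLRσ : L * R₀ ≤ σmin / 12 := by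
    rw [hLR, div_le_div_iff₀ (by positivity) (by norm_num)]
    have h1 : δ * σmin ^ 2 ≤ σmin * a := by
      calc δ * σmin ^ 2 ≤ 1 * σmin ^ 2 := mul_le_mul_of_nonneg_right hδ1.le (by positivity)
        _ = σmin * σmin := by ring
        _ ≤ σmin * a := mul_le_mul_of_nonneg_left hσa hσ.le
    have h2 : 1 * (σmin * a) ≤ κ ^ 2 * (σmin * a) :=
      mul_le_mul_of_nonneg_right (one_le_pow₀ hκ) (by positivity)
    nlinarith
  -- the a priori estimate
  have step : ∀ T S : ℝ, 0 ≤ T → S ≤ R₀ → (∀ s ∈ Set.Icc 0 T, R s ≤ S) →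
      R T ≤ 2 * E0 / α + S / 8 := by
    intro T S hT hS hRS
    have hS0 : 0 ≤ S := (hRnn 0).trans (hRS 0 ⟨le_rfl, hT⟩)
    have hD : ∀ s ∈ Set.Icc 0 T, matOpNorm (DV (w s) - A) ≤ L * S := fun s hs =>
      (hLip (w s) w₀).trans (mul_le_mul_of_nonneg_left (hRS s hs) hL.le)
    have hLS : L * S ≤ L * R₀ := mul_le_mul_of_nonneg_left hS hL.le
    have hq : ∀ s ∈ Set.Icc 0 T, HasDerivAt (fun s => inner0 A (e s) (e s))
        (2 * inner0 A (e s) (DV (w s) *ᵥ ((DV (w s))ᵀ *ᵥ (Matrix.diagonal μ *ᵥ g s)))) s :=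
      fun s hs => inner0_deriv hu (hed s hs.1)
    have hq' : ∀ s ∈ Set.Icc 0 T,
        2 * inner0 A (e s) (DV (w s) *ᵥ ((DV (w s))ᵀ *ᵥ (Matrix.diagonal μ *ᵥ g s)))
          ≤ - δ * muNorm μ (e s) ^ 2 := fun s hs =>
      energy_pt hσ hu hσmin hμ_pos hκ hκ1 hκ2 (DV (w s)) (e s) (g s) ha0
        (hLR ▸ (hD s hs).trans hLS) (by have := hD s hs; linarith) (hg2 s) (heg s)
    have hanti : norm0 A (e T) ≤ E0 := by
      apply Real.sqrt_le_sqrt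
      have : AntitoneOn (fun s => inner0 A (e s) (e s)) (Set.Icc 0 T) := by
        apply antitoneOn_of_deriv_nonpos (convex_Icc 0 T)
        · exact fun s hs => (hq s hs).continuousAt.continuousWithinAt
        · exact fun s hs => (hq s (interior_subset hs)).differentiableAt.differentiableWithinAt
        · intro s hs
          rw [(hq s (interior_subset hs)).deriv]
          refine (hq' s (interior_subset hs)).trans ?_
          have := sq_nonneg (muNorm μ (e s))
          nlinarith
      exact this ⟨le_rfl, hT⟩ ⟨hT, le_rfl⟩ hT
    -- kernel part
    have hker : eNorm (QQ A (w T - w₀)) ≤ S / 24 := by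
      have hk := kernel_abs (T := T) (κ := κ) (δ := δ) (c := 2 * (L * S) * κ / σmin / α)
        (k := fun s => WithLp.toLp 2 (QQ A (w s - w₀)))
        (k' := fun s => WithLp.toLp 2
          (QQ A ((1 / α) • ((DV (w s))ᵀ *ᵥ (Matrix.diagonal μ *ᵥ g s)))))
        (q := fun s => inner0 A (e s) (e s)) (m := fun s => muNorm μ (e s))
        hT hκ hδ (by positivity) (by simp [hw0, QQ, JJ])
        (fun s hs => toLp_deriv (QQ_deriv ((hwd s hs.1).sub_const w₀)))
        (fun s hs => by
          have h1 : ∀ x : Fin p → ℝ, QQ A ((1 / α) • x) = (1 / α) • QQ A x := fun x => by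
            simp only [QQ, Matrix.mulVec_smul, JJ_smul, smul_sub]
          have h2 := kernel_pt hσ hu hσmin hμ_pos hκ hκ2 (DV (w s)) (e s) (g s) (hD s hs) (hg2 s)
          rw [← eNorm_eq, h1, eNorm_smul, abs_of_pos (by positivity)]
          calc _ ≤ _ := mul_le_mul_of_nonneg_left h2 (by positivity)
            _ = _ := by ring)
        hq hq' (fun s => by rw [norm0_sq hu]; positivity) (fun s => muNorm_nonneg _)
        (fun s => by
          rw [norm0_sq hu, ← mul_pow]
          exact pow_le_pow_left₀ (norm0_nonneg _) (hκ1 _) 2)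
      rw [← eNorm_eq] at hk
      change _ ≤ _ * (_ * E0) at hk
      refine hk.trans ?_
      calc _ ≤ 2 * (L * S) * κ / σmin / α * (2 * κ / δ * (2 * α * M)) :=
            mul_le_mul_of_nonneg_left
              (mul_le_mul_of_nonneg_left hE0M.le (by positivity)) (by positivity)
        _ = S * (δ * σmin / a / 24) := by rw [hMdef]; field_simp; ring
        _ ≤ S * (1 / 24) := by
            apply mul_le_mul_of_nonneg_left _ hS0
            have : δ * σmin / a ≤ 1 := by
              rw [div_le_one ha0]
              exact (mul_le_of_le_one_left hσ.le hδ1.le).trans hσa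
            linarith
        _ = S / 24 := by ring
    -- range part
    have hrange : norm0 A (A *ᵥ (w T - w₀)) ≤ 2 * E0 / α + S / 12 := by
      have hrem := rem_bound V DV hV L hL hLip w₀ (w T - w₀)
      rw [add_sub_cancel] at hrem
      have hRT := hRS T ⟨hT, le_rfl⟩
      have hRT0 := hRnn T
      have h1 : A *ᵥ (w T - w₀) = (1 / α) • (e T - e 0)
          - (V (w T) - V w₀ - A *ᵥ (w T - w₀)) := by
        have : (1 / α) • (e T - e 0) = V (w T) - V w₀ := by
          simp only [e, hw0, sub_sub_sub_cancel_right]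
          rw [← smul_sub, smul_smul, one_div_mul_cancel hα0.ne', one_smul]
        rw [this]; abel
      rw [h1]
      refine (norm0_sub_le hu _ _).trans (add_le_add ?_ ?_)
      · rw [norm0_smul hu, abs_of_pos (by positivity)]
        have := norm0_sub_le hu (e T) (e 0)
        calc _ ≤ 1 / α * (2 * E0) := mul_le_mul_of_nonneg_left (by linarith) (by positivity)
          _ = _ := by ring
      · refine (norm0_le hσ hu hσmin _).trans ?_
        rw [div_le_iff₀ hσ]
        calc _ ≤ L * eNorm (w T - w₀) ^ 2 := hrem
          _ ≤ L * S ^ 2 := mul_le_mul_of_nonneg_left (pow_le_pow_left₀ hRT0 hRT 2) hL.le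
          _ = (L * S) * S := by ring
          _ ≤ (σmin / 12) * S := mul_le_mul_of_nonneg_right (hLS.trans hLRσ) hS0
          _ = _ := by ring
    have := eNorm_split hu (w T - w₀)
    change eNorm (w T - w₀) ≤ _
    linarith
  have hRcont : ∀ T, ContinuousOn R (Set.Icc 0 T) := by
    intro T s hs
    have h1 := (toLp_deriv ((hwd s hs.1).sub_const w₀)).continuousAt.norm
    have h2 : R = fun s => ‖WithLp.toLp 2 (w s - w₀)‖ := by ext s; exact eNorm_eq _
    rw [h2]
    exact h1.continuousWithinAt
  have step2 : ∀ T : ℝ, 0 ≤ T → (∀ s ∈ Set.Icc 0 T, R s ≤ R₀) → R T ≤ 4 * E0 / α := by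
    intro T hT hle
    obtain ⟨s, hs, hmax⟩ := isCompact_Icc.exists_isMaxOn (Set.nonempty_Icc.2 hT) (hRcont T)
    have h1 := step s (R s) hs.1 (hle s hs) (fun x hx => hmax ⟨hx.1, hx.2.trans hs.2⟩)
    have h2 : R T ≤ R s := hmax ⟨hT, le_rfl⟩
    have h3 : 4 * E0 / α = 2 * (2 * E0 / α) := by ring
    have h4 : 0 ≤ 2 * E0 / α := by positivity
    linarith
  have hsmall : 4 * E0 / α < R₀ := by
    rw [div_lt_iff₀ hα0]
    nlinarith [mul_pos hα0 hM0, mul_pos hα0 hR₀pos]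
  have hall : ∀ T : ℝ, 0 ≤ T → ∀ s ∈ Set.Icc 0 T, R s ≤ R₀ := by
    by_contra hcon
    push Not at hcon
    obtain ⟨T, hT, s, hs, hsR⟩ := hcon
    have hcl : IsCompact (Set.Icc 0 T ∩ R ⁻¹' Set.Ici R₀) := by
      apply isCompact_Icc.of_isClosed_subset _ Set.inter_subset_left
      exact (hRcont T).preimage_isClosed_of_isClosed isClosed_Icc isClosed_Ici
    obtain ⟨τ, hτ, hleast⟩ := hcl.exists_isLeast ⟨s, hs, hsR.le⟩
    have hτ0 : 0 ≤ τ := hτ.1.1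
    have hτR : R₀ ≤ R τ := hτ.2
    have hlt : ∀ x ∈ Set.Icc 0 τ, R x ≤ R₀ := by
      intro x hx
      by_contra hx'
      push Not at hx'
      obtain ⟨y, hy, hyR⟩ := intermediate_value_Icc hx.1 (hRcont x)
        (show R₀ ∈ Set.Icc (R 0) (R x) from ⟨hR0.le.trans hR₀pos.le, hx'.le⟩)
      have h1 : τ ≤ y := hleast ⟨⟨hy.1, hy.2.trans (hx.2.trans hτ.1.2)⟩, hyR.ge⟩
      have h2 : y = x := le_antisymm hy.2 (hx.2.trans h1)
      rw [h2] at hyR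
      linarith
    have := step2 τ hτ0 hlt
    linarith
  intro t ht
  have hfin := step2 t ht (hall t ht)
  refine hfin.trans ?_
  have hc : 1 ≤ κ ^ 2 * a / δ := by
    rw [le_div_iff₀ hδ]
    nlinarith
  have hpos : 0 ≤ C + norm0 A Vs := by positivity
  calc 4 * E0 / α ≤ 4 * (C + norm0 A Vs) / α := by gcongr
    _ = 1 * (4 * (C + norm0 A Vs) / α) := by ring
    _ ≤ κ ^ 2 * a / δ * (4 * (C + norm0 A Vs) / α) :=
      mul_le_mul_of_nonneg_right hc (by positivity)
    _ = _ := by field_simp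
end
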